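/- arXiv:1906.11650 — 2 statements merged into one kernel-verified Lean document; each statement's English description precedes it below -/
import Mathlib

section
/- Let χ : G_ℚ → {±1} be a character with χ(−1) = 1 and let supp(χ) := {p prime : χ(p) = −1}. If supp(χ) contains at least two distinct primes, then [a]_χ = [a + t]_χ in (RP′(ℚ)[1/2])_χ for all a ∈ ℚ and all t ∈ ℤ, where by convention [0] := C_ℚ. -/
open scoped Classical

noncomputable section

variable (F : Type) [Field F]

/-- The group of square classes `G_F = F^× / (F^×)²`. -/
def SqCl (F : Type) [Field F] : Type :=
  Fˣ ⧸ (powMonoidHom 2 : Fˣ →* Fˣ).range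

instance : CommGroup (SqCl F) := QuotientGroup.Quotient.commGroup _

/-- The square class of a unit. -/
def sqc : Fˣ →* SqCl F := QuotientGroup.mk' _

/-- The group ring `R_F = ℤ[F^×/(F^×)²]`. -/
abbrev RF (F : Type) [Field F] : Type := MonoidAlgebra ℤ (SqCl F)

/-- `⟨x⟩ ∈ R_F`, the square class of a unit as an element of the group ring. -/
def cls (x : Fˣ) : RF F := MonoidAlgebra.of ℤ (SqCl F) (sqc F x)

/-- The free `R_F`-module on the set `F^×`. -/
abbrev FreeRP (F : Type) [Field F] : Type := Fˣ →₀ RF F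

/-- The generator `[x]` of the free module. -/
def gen (x : Fˣ) : FreeRP F := Finsupp.single x 1

/-- units from nonzero field elements -/
def U (x : F) (h : x ≠ 0) : Fˣ := Units.mk0 x h

variable {F}

theorem one_sub_ne {x : Fˣ} (hx : (x : F) ≠ 1) : (1 : F) - x ≠ 0 :=
  sub_ne_zero.mpr (Ne.symm hx)

theorem inv_sub_one_ne {x : Fˣ} (hx : (x : F) ≠ 1) : ((x : F)⁻¹ - 1) ≠ 0 :=
  sub_ne_zero.mpr (fun h => hx (by rwa [inv_eq_one] at h))

theorem one_sub_inv_ne {x : Fˣ} (hx : (x : F) ≠ 1) : (1 - (x : F)⁻¹) ≠ 0 :=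
  sub_ne_zero.mpr (fun h => hx (by rw [eq_comm, inv_eq_one] at h; exact h.symm ▸ rfl))

variable (F)

/-- The five term relation `S_{x,y}` as an element of the free module. -/
def FT (x y : Fˣ) (hx : (x : F) ≠ 1) (hy : (y : F) ≠ 1) : FreeRP F :=
  gen F x - gen F y + cls F x • gen F (y * x⁻¹)
    - cls F (U F ((x : F)⁻¹ - 1) (inv_sub_one_ne hx)) •
        gen F (U F ((1 - (x : F)⁻¹) / (1 - (y : F)⁻¹))
          (div_ne_zero (one_sub_inv_ne hx) (one_sub_inv_ne hy)))
    + cls F (U F (1 - (x : F)) (one_sub_ne hx)) •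
        gen F (U F ((1 - (x : F)) / (1 - (y : F)))
          (div_ne_zero (one_sub_ne hx) (one_sub_ne hy)))

/-- The set of five-term relations. -/
def ftRels : Set (FreeRP F) :=
  {w | ∃ (x y : Fˣ) (hx : (x : F) ≠ 1) (hy : (y : F) ≠ 1), w = FT F x y hx hy}

/-- The relations `ψ₁(x) = [x] + ⟨-1⟩[x⁻¹]`. -/
def psiRels : Set (FreeRP F) :=
  {w | ∃ x : Fˣ, w = gen F x + cls F (-1) • gen F x⁻¹}

/-- relations `⟨-1⟩[x] = [x]` -/
def minusRels : Set (FreeRP F) :=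
  {w | ∃ x : Fˣ, w = cls F (-1) • gen F x - gen F x}

/-- relations `[x⁻¹] = -[x]` -/
def invRels : Set (FreeRP F) :=
  {w | ∃ x : Fˣ, w = gen F x⁻¹ + gen F x}

/-- The module `qRP(F) = RP(F)/⟨ψ₁(x) : x ∈ F^×⟩`. -/
def qRP : Type := FreeRP F ⧸ Submodule.span (RF F) (ftRels F ∪ psiRels F)

instance : AddCommGroup (qRP F) := by unfold qRP; infer_instance
instance : Module (RF F) (qRP F) := by unfold qRP; infer_instance

/-- `[x] ∈ qRP(F)` -/
def qrp (x : Fˣ) : qRP F := Submodule.Quotient.mk (gen F x)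

/-- The module `RP′(F)`. -/
def RP' : Type :=
  FreeRP F ⧸ Submodule.span (RF F)
    ({gen F 1} ∪ ftRels F ∪ minusRels F ∪ invRels F)

instance : AddCommGroup (RP' F) := by unfold RP'; infer_instance
instance : Module (RF F) (RP' F) := by unfold RP'; infer_instance

/-- `[x] ∈ RP′(F)` -/
def rp (x : Fˣ) : RP' F := Submodule.Quotient.mk (gen F x)

/-- the submodule of `M` generated by the elements `(⟨a⟩ - χ(a))·m`. -/
def chiSub (χ : SqCl F →* ℤˣ) (M : Type) [AddCommGroup M] [Module (RF F) M] :
    Submodule (RF F) M :=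
  Submodule.span (RF F)
    {w | ∃ (a : Fˣ) (m : M), w = cls F a • m - ((χ (sqc F a) : ℤ)) • m}

/-- `M_χ` -/
def ChiQuot (χ : SqCl F →* ℤˣ) (M : Type) [AddCommGroup M] [Module (RF F) M] : Type :=
  M ⧸ chiSub F χ M

instance (χ : SqCl F →* ℤˣ) (M : Type) [AddCommGroup M] [Module (RF F) M] :
    AddCommGroup (ChiQuot F χ M) := by unfold ChiQuot; infer_instance
instance (χ : SqCl F →* ℤˣ) (M : Type) [AddCommGroup M] [Module (RF F) M] :
    Module (RF F) (ChiQuot F χ M) := by unfold ChiQuot; infer_instance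

/-- image of `m` in `M_χ` -/
def mkChi (χ : SqCl F →* ℤˣ) {M : Type} [AddCommGroup M] [Module (RF F) M] (m : M) :
    ChiQuot F χ M := Submodule.Quotient.mk m

/-- `M[1/2]`, as an `R_F`-module (localization at the powers of `2`). -/
def Loc2 (M : Type) [AddCommGroup M] [Module (RF F) M] : Type :=
  LocalizedModule (Submonoid.powers (2 : RF F)) M

instance (M : Type) [AddCommGroup M] [Module (RF F) M] : AddCommGroup (Loc2 F M) := by
  unfold Loc2; infer_instance
instance (M : Type) [AddCommGroup M] [Module (RF F) M] : Module (RF F) (Loc2 F M) := by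
  unfold Loc2; infer_instance

/-- the canonical map `M → M[1/2]` -/
def toLoc2 {M : Type} [AddCommGroup M] [Module (RF F) M] (m : M) : Loc2 F M :=
  LocalizedModule.mkLinearMap (Submonoid.powers (2 : RF F)) M m


/-- the square class of a field element (junk value `1` at `0`). -/
def sqv (a : F) : SqCl F := if h : a ≠ 0 then sqc F (U F a h) else 1

/-- `[a] ∈ RP′(F)` for a field element `a`, where `[0]` is assigned the value `c₀`. -/
def rpc (c₀ : RP' F) (a : F) : RP' F := if h : a ≠ 0 then rp F (U F a h) else c₀

end

noncomputable section

namespace St17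

structure Dat (M : Type) [AddCommGroup M] where
  χ : ℚ →*₀ ℤ
  hχ : ∀ x : ℚ, x ≠ 0 → χ x = 1 ∨ χ x = -1
  hm : χ (-1) = 1
  h2 : ∀ m : M, (2 : ℤ) • m = 0 → m = 0
  c : M
  f : ℚ → M
  f0 : f 0 = c
  f1 : f 1 = 0
  finv : ∀ x, x ≠ 0 → f x⁻¹ = - f x
  fc : ∀ x, x ≠ 0 → x ≠ 1 → f x + f (1 - x) = c
  ft : ∀ x y, x ≠ 0 → x ≠ 1 → y ≠ 0 → y ≠ 1 →
    f x - f y + χ x • f (y / x) - χ (x⁻¹ - 1) • f ((1 - x⁻¹) / (1 - y⁻¹))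
      + χ (1 - x) • f ((1 - x) / (1 - y)) = 0

namespace Dat

variable {M : Type} [AddCommGroup M] (D : Dat M)

theorem ne0 {x : ℚ} (h : D.χ x = 1 ∨ D.χ x = -1) : x ≠ 0 := by
  rintro rfl
  simp at h

theorem chi_neg (x : ℚ) : D.χ (-x) = D.χ x := by
  rw [neg_eq_neg_one_mul, map_mul, D.hm, one_mul]

theorem chi_sub (x y : ℚ) : D.χ (x - y) = D.χ (y - x) := by
  rw [← D.chi_neg, neg_sub]

theorem chi_inv (x : ℚ) : D.χ x⁻¹ = D.χ x := by
  by_cases h : x = 0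
  · simp [h]
  have h1 : D.χ x⁻¹ * D.χ x = 1 := by
    rw [← map_mul, inv_mul_cancel₀ h, map_one]
  rcases D.hχ x h with h2 | h2 <;> rw [h2] at h1 ⊢ <;> omega

theorem chi_div (x y : ℚ) : D.χ (x / y) = D.χ x * D.χ y := by
  rw [div_eq_mul_inv, map_mul, chi_inv]

theorem chi_sq {x : ℚ} (h : x ≠ 0) : D.χ x * D.χ x = 1 := by
  rcases D.hχ x h with h | h <;> rw [h] <;> rfl

theorem ne1 {x : ℚ} (h : D.χ x = -1) : x ≠ 1 := by
  rintro rfl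
  simp at h

theorem fm1 : D.f (-1) = 0 := by
  have := D.finv (-1) (by norm_num)
  apply D.h2
  rw [inv_neg, inv_one] at this
  rw [two_smul]; nth_rw 1 [this]; simp

/-- antisymmetrised five term relation -/
theorem L1 {u v : ℚ} (hu : D.χ u = -1) (hv : D.χ v = 1) :
    D.χ (1 - u) • D.f u = D.χ (1 - u * v) • D.f (u * v) := by
  by_cases hv1 : v = 1
  · simp [hv1]
  have huv : D.χ (u * v) = -1 := by rw [map_mul, hu, hv]; rfl
  have u0 := D.ne0 (Or.inr hu)
  have v0 := D.ne0 (Or.inl hv)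
  have u1 : 1 - u ≠ 0 := sub_ne_zero.mpr (D.ne1 hu).symm
  have uv1 : 1 - u * v ≠ 0 := sub_ne_zero.mpr (D.ne1 huv).symm
  have v1 : 1 - v ≠ 0 := sub_ne_zero.mpr (Ne.symm hv1)
  obtain ⟨x, hx⟩ : ∃ x, x = (1 - v) / (1 - u * v) := ⟨_, rfl⟩
  obtain ⟨y, hy⟩ : ∃ y, y = u * x := ⟨_, rfl⟩
  have x0 : x ≠ 0 := by rw [hx]; exact div_ne_zero v1 uv1
  have y0 : y ≠ 0 := by rw [hy]; exact mul_ne_zero u0 x0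
  have hx1 : 1 - x = v * (1 - u) / (1 - u * v) := by
    rw [hx, eq_div_iff uv1, sub_mul, div_mul_cancel₀ _ uv1]; ring
  have hy1 : 1 - y = (1 - u) / (1 - u * v) := by
    rw [hy, hx, eq_div_iff uv1, sub_mul, mul_assoc, div_mul_cancel₀ _ uv1]; ring
  have x1' : 1 - x ≠ 0 := by rw [hx1]; exact div_ne_zero (mul_ne_zero v0 u1) uv1
  have y1' : 1 - y ≠ 0 := by rw [hy1]; exact div_ne_zero u1 uv1
  have x1 : x ≠ 1 := fun h => x1' (by rw [h]; ring)
  have y1 : y ≠ 1 := fun h => y1' (by rw [h]; ring)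
  have e1 := D.ft x y x0 x1 y0 y1
  have e2 := D.ft y x y0 y1 x0 x1
  have k1 : y / x = u := by rw [hy]; field_simp
  have k1' : x / y = u⁻¹ := by rw [← k1, inv_div]
  have k2 : (1 - x) / (1 - y) = v := by
    rw [hx1, hy1, div_div_div_cancel_right₀ uv1, mul_div_assoc, div_self u1, mul_one]
  have k2' : (1 - y) / (1 - x) = v⁻¹ := by rw [← k2, inv_div]
  have k3 : (1 - x⁻¹) / (1 - y⁻¹) = u * v := by
    have : (1 - x⁻¹) / (1 - y⁻¹) = (y / x) * ((1 - x) / (1 - y)) := by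
      have : y - 1 ≠ 0 := sub_ne_zero.mpr y1
      have h3 : 1 - y⁻¹ ≠ 0 := by
        intro h; apply this; field_simp at h; simpa using h
      rw [div_eq_iff h3]; field_simp; ring
    rw [this, k1, k2]
  have k3' : (1 - y⁻¹) / (1 - x⁻¹) = (u * v)⁻¹ := by rw [← k3, inv_div]
  rw [k1, k2, k3] at e1
  rw [k1', k2', k3', D.finv _ u0, D.finv _ v0, D.finv _ (mul_ne_zero u0 v0)] at e2
  have c1 : D.χ y = - D.χ x := by rw [hy, map_mul, hu]; ring
  have c2 : D.χ (1 - x) = D.χ (1 - u) * D.χ (1 - u * v) := by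
    rw [hx1, D.chi_div, map_mul, hv]; ring
  have c3 : D.χ (1 - y) = D.χ (1 - u) * D.χ (1 - u * v) := by
    rw [hy1, D.chi_div]
  have c4 : D.χ (x⁻¹ - 1) = D.χ x * D.χ (1 - x) := by
    rw [mul_comm, ← D.chi_div]; congr 1; field_simp
  have c5 : D.χ (y⁻¹ - 1) = D.χ y * D.χ (1 - y) := by
    rw [mul_comm, ← D.chi_div]; congr 1; field_simp
  rw [c4, c2] at e1
  rw [c5, c3, c1] at e2
  rw [← sub_eq_zero]
  apply D.h2
  rcases D.hχ x x0 with h | h <;> rcases D.hχ _ u1 with h' | h' <;>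
    rcases D.hχ _ uv1 with h'' | h'' <;> rw [h, h', h''] at e1 e2 <;> rw [h', h''] <;>
    first
    | linear_combination (norm := module) e1 + e2
    | linear_combination (norm := module) (-1 : ℤ) • e1 + (-1 : ℤ) • e2


theorem h3' (D : Dat M) {m n : M} (h : (2 : ℤ) • m = (2 : ℤ) • n) : m = n := by
  rw [← sub_eq_zero]
  apply D.h2
  rw [smul_sub, h, sub_self]

theorem exg : ∃ g : M, ∀ u, D.χ u = -1 → D.f u = D.χ (1 - u) • g := by
  by_cases h : ∃ u, D.χ u = -1
  · obtain ⟨p, hp⟩ := h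
    refine ⟨D.χ (1 - p) • D.f p, fun u hu => ?_⟩
    have p0 := D.ne0 (Or.inr hp)
    have h1 := D.L1 (u := p) (v := u / p) hp (by rw [D.chi_div, hu, hp]; rfl)
    rw [mul_div_cancel₀ _ p0] at h1
    rw [h1, smul_smul, D.chi_sq (sub_ne_zero.mpr (D.ne1 hu).symm), one_smul]
  · exact ⟨0, fun u hu => absurd ⟨u, hu⟩ h⟩

/-- basic consequences of the existence of a nontrivial value -/
theorem basic {p : ℚ} (hp : D.χ p = -1) :
    (3 : ℤ) • D.c = 0 ∧ (∀ u, D.χ u = -1 → D.f u = D.χ (1 - u) • D.c) ∧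
      (∀ w, D.χ w = 1 → D.χ (1 - w) = -1 → D.f w = 0) := by
  obtain ⟨g, hg⟩ := D.exg
  have p0 := D.ne0 (Or.inr hp)
  have p1 : 1 - p ≠ 0 := sub_ne_zero.mpr (D.ne1 hp).symm
  have hpi : D.χ p⁻¹ = -1 := by rw [D.chi_inv, hp]
  have hpi1 : D.χ (1 - p⁻¹) = - D.χ (1 - p) := by
    have : 1 - p⁻¹ = - ((1 - p) / p) := by field_simp; ring
    rw [this, D.chi_neg, D.chi_div, hp]; ring
  have A : ∃ x, D.χ x = -1 ∧ D.χ (1 - x) = -1 := by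
    rcases D.hχ _ p1 with h | h
    · exact ⟨p⁻¹, hpi, by rw [hpi1, h]⟩
    · exact ⟨p, hp, h⟩
  have B : ∃ x, D.χ x = -1 ∧ D.χ (1 - x) = 1 := by
    rcases D.hχ _ p1 with h | h
    · exact ⟨p, hp, h⟩
    · exact ⟨p⁻¹, hpi, by rw [hpi1, h]; rfl⟩
  have e1 : D.c = (-2 : ℤ) • g := by
    obtain ⟨x, h1, h2⟩ := A
    rw [← D.fc x (D.ne0 (Or.inr h1)) (D.ne1 h1), hg x h1, hg _ h2, sub_sub_cancel, h1, h2]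
    module
  have W : ∀ w, D.χ w = 1 → D.χ (1 - w) = -1 → D.f w = D.c - g := by
    intro w h1 h2
    have h3 : w ≠ 1 := by rintro rfl; simp at h2
    rw [← D.fc w (D.ne0 (Or.inl h1)) h3, hg _ h2, sub_sub_cancel, h1, one_smul]; abel
  have e2 : D.c = g := by
    obtain ⟨x, h1, h2⟩ := B
    have w0 := D.ne0 (Or.inl h2)
    have q1 := W (1 - x) h2 (by rw [sub_sub_cancel, h1])
    have q2 := W (1 - x)⁻¹ (by rw [D.chi_inv, h2]) (by
      have : 1 - (1 - x)⁻¹ = - (x / (1 - x)) := by field_simp; ring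
      rw [this, D.chi_neg, D.chi_div, h1, h2]; rfl)
    rw [D.finv _ w0, q1] at q2
    apply D.h3'
    linear_combination (norm := module) (-1 : ℤ) • q2
  refine ⟨?_, ?_, ?_⟩
  · rw [← e2] at e1
    linear_combination (norm := module) e1
  · rw [e2]; exact hg
  · intro w h1 h2
    rw [W w h1 h2, e2, sub_self]

/-- the main relation for `y` in `H` -/
theorem L4 {x y : ℚ} (hx : D.χ x = -1) (hx1 : D.χ (1 - x) = 1) (hy : D.χ y = 1)
    (hy1 : D.χ (1 - y) = 1) : D.f y = D.c + D.f ((1 - x) / (1 - y)) := by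
  obtain ⟨-, hu, -⟩ := D.basic hx
  have x0 := D.ne0 (Or.inr hx)
  have y0 := D.ne0 (Or.inl hy)
  have x1 := D.ne1 hx
  have y1' := D.ne0 (Or.inl hy1)
  have y1 : y ≠ 1 := fun h => y1' (by rw [h]; ring)
  have xy : x - y ≠ 0 := by
    intro h
    rw [sub_eq_zero] at h
    rw [h, hy] at hx
    norm_num at hx
  have e := D.ft x y x0 x1 y0 y1
  have k1 : D.χ (x⁻¹ - 1) = -1 := by
    have : x⁻¹ - 1 = (1 - x) / x := by field_simp
    rw [this, D.chi_div, hx1, hx]; rfl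
  have k2 : D.χ (1 - y⁻¹) = 1 := by
    have : 1 - y⁻¹ = - ((1 - y) / y) := by field_simp; ring
    rw [this, D.chi_neg, D.chi_div, hy1, hy]; rfl
  have yi := D.ne0 (Or.inl k2)
  have e1 : D.f (y / x) = - D.χ (x - y) • D.c := by
    rw [hu _ (by rw [D.chi_div, hx, hy]; rfl)]
    have : 1 - y / x = (x - y) / x := by field_simp
    rw [this, D.chi_div, hx, mul_neg, mul_one]
  have e2 : D.f ((1 - x⁻¹) / (1 - y⁻¹)) = - D.χ (x - y) • D.c := by
    rw [hu _ (by rw [D.chi_div, k2, D.chi_sub, k1]; rfl)]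
    have h1 : 1 - (1 - x⁻¹) / (1 - y⁻¹) = (x⁻¹ - y⁻¹) / (1 - y⁻¹) := by
      rw [eq_div_iff yi, sub_mul, div_mul_cancel₀ _ yi]; ring
    have h2 : x⁻¹ - y⁻¹ = - ((x - y) / (x * y)) := by field_simp; ring
    rw [h1, D.chi_div, k2, h2, D.chi_neg, D.chi_div, map_mul, hx, hy]; simp
  have e3 : D.f x = D.c := by rw [hu x hx, hx1, one_smul]
  rw [e1, e2, e3, k1, hx, hx1] at e
  linear_combination (norm := module) (-1 : ℤ) • e

theorem P1 {x y : ℚ} (hy : D.χ y = 1) (hy1 : D.χ (1 - y) = 1) (hx : D.χ x = -1)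
    (hx1 : D.χ (1 - x) = 1) (hxy : D.χ (x - y) = -1) : D.f y = D.c := by
  obtain ⟨-, -, hw⟩ := D.basic hx
  have y1' := D.ne0 (Or.inl hy1)
  rw [D.L4 hx hx1 hy hy1, hw, add_zero]
  · rw [D.chi_div, hx1, hy1]; rfl
  · have : 1 - (1 - x) / (1 - y) = (x - y) / (1 - y) := by field_simp; ring
    rw [this, D.chi_div, hxy, hy1]; rfl

theorem P2 {x y : ℚ} (hy : D.χ y = 1) (hy1 : D.χ (1 - y) = 1) (hx : D.χ x = 1)
    (hx1 : D.χ (1 - x) = -1) (hxy : D.χ (x - y) = -1) : D.f y = 0 := by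
  have y1' := D.ne0 (Or.inl hy1)
  have y1 : y ≠ 1 := fun h => y1' (by rw [h]; ring)
  have h := D.P1 (x := 1 - x) (y := 1 - y) hy1 (by rwa [sub_sub_cancel]) hx1
    (by rwa [sub_sub_cancel]) (by rw [sub_sub_sub_cancel_left, D.chi_sub, hxy])
  have h2 := D.fc y (D.ne0 (Or.inl hy)) y1
  rw [h] at h2
  simpa using h2

theorem P3 {x y : ℚ} (hy : D.χ y = 1) (hy1 : D.χ (1 - y) = 1) (hx : D.χ x = -1)
    (hx1 : D.χ (1 - x) = -1) (hxy : D.χ (x - y) = 1) : D.f y = - D.c := by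
  have x0 := D.ne0 (Or.inr hx)
  have y0 := D.ne0 (Or.inl hy)
  have h := D.P1 (x := x⁻¹) (y := y⁻¹) (by rw [D.chi_inv, hy])
    (by
      have : 1 - y⁻¹ = - ((1 - y) / y) := by field_simp; ring
      rw [this, D.chi_neg, D.chi_div, hy1, hy]; rfl)
    (by rw [D.chi_inv, hx])
    (by
      have : 1 - x⁻¹ = - ((1 - x) / x) := by field_simp; ring
      rw [this, D.chi_neg, D.chi_div, hx1, hx]; rfl)
    (by
      have h2 : x⁻¹ - y⁻¹ = - ((x - y) / (x * y)) := by field_simp; ring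
      rw [h2, D.chi_neg, D.chi_div, map_mul, hx, hy, hxy]; simp)
  rw [D.finv _ y0] at h
  rw [← h, neg_neg]

theorem c_of_neg (h : D.c = - D.c) : D.c = 0 := by
  apply D.h2
  rw [two_smul]; nth_rw 1 [h]; simp

theorem L5H (hc : D.c = 0) {y w : ℚ} (hy : D.χ y = 1) (hy1 : D.χ (1 - y) = 1)
    (hw : D.χ w = 1) (hw1 : D.χ (1 - w) = -1) : D.f (y * w) = D.f y := by
  have y0 := D.ne0 (Or.inl hy)
  have w0 := D.ne0 (Or.inl hw)
  have y1' := D.ne0 (Or.inl hy1)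
  have y1 : y ≠ 1 := fun h => y1' (by rw [h]; ring)
  have h := D.L4 (x := 1 - w⁻¹) (y := 1 - y)
    (by
      have : 1 - w⁻¹ = - ((1 - w) / w) := by field_simp; ring
      rw [this, D.chi_neg, D.chi_div, hw1, hw]; rfl)
    (by rw [sub_sub_cancel, D.chi_inv, hw]) hy1 (by rwa [sub_sub_cancel])
  have h2 := D.fc y y0 y1
  have : (1 - (1 - w⁻¹)) / (1 - (1 - y)) = (y * w)⁻¹ := by
    rw [sub_sub_cancel, sub_sub_cancel]; field_simp
  rw [this, D.finv _ (mul_ne_zero y0 w0), hc] at h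
  rw [hc, h] at h2
  linear_combination (norm := module) (-1 : ℤ) • h2

theorem L5 (hc : D.c = 0) {y w : ℚ} (hy : D.χ y = 1)
    (hw : D.χ w = 1) (hw1 : D.χ (1 - w) = -1) : D.f (y * w) = D.f y := by
  obtain ⟨-, -, hW⟩ := D.basic hw1
  have w0 := D.ne0 (Or.inl hw)
  by_cases y1 : y = 1
  · rw [y1, one_mul, D.f1, hW w hw hw1]
  rcases D.hχ (1 - y) (sub_ne_zero.mpr (Ne.symm y1)) with h | h
  · exact D.L5H hc hy h hw hw1
  rw [hW y hy h]
  by_cases yw : y * w = 1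
  · rw [yw, D.f1]
  have hyw : D.χ (y * w) = 1 := by rw [map_mul, hy, hw]; rfl
  rcases D.hχ (1 - y * w) (sub_ne_zero.mpr (Ne.symm yw)) with h' | h'
  · have := D.L5H hc (y := y * w) (w := w⁻¹) hyw h' (by rw [D.chi_inv, hw])
      (by
        have : 1 - w⁻¹ = - ((1 - w) / w) := by field_simp; ring
        rw [this, D.chi_neg, D.chi_div, hw1, hw]; rfl)
    rw [mul_inv_cancel_right₀ w0, hW y hy h] at this
    exact this.symm
  · exact hW _ hyw h'

theorem S (hc : D.c = 0) {u a : ℚ} (hu : D.χ u = -1) (hu1 : D.χ (1 + u) = 1)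
    (ha : D.χ a = 1) : D.f (a + u) = D.f a := by
  obtain ⟨-, hU, hW⟩ := D.basic hu
  have a0 := D.ne0 (Or.inl ha)
  have au : a + u ≠ 0 := by
    intro h
    have : a = -u := by linarith
    rw [this, D.chi_neg, hu] at ha
    norm_num at ha
  rcases D.hχ _ au with h | h
  · have := D.L5 hc (y := a) (w := (a + u) / a) ha (by rw [D.chi_div, h, ha]; rfl)
      (by
        have : 1 - (a + u) / a = - (u / a) := by field_simp; ring
        rw [this, D.chi_neg, D.chi_div, hu, ha]; rfl)
    rwa [mul_div_cancel₀ _ a0] at this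
  · rw [hU _ h, hc, smul_zero]
    by_cases a1 : a = 1
    · rw [a1, D.f1]
    rcases D.hχ (1 - a) (sub_ne_zero.mpr (Ne.symm a1)) with h' | h'
    · rw [D.P1 (x := -u) ha h' (by rw [D.chi_neg, hu]) (by rwa [sub_neg_eq_add])
        (by rw [← neg_add', D.chi_neg, add_comm, h]), hc]
    · rw [hW a ha h']

def T : AddSubgroup ℚ where
  carrier := {t | ∀ a, D.f (a + t) = D.f a}
  zero_mem' := by intro a; rw [add_zero]
  add_mem' := by
    intro s t hs ht a
    rw [← add_assoc, ht, hs]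
  neg_mem' := by
    intro t ht a
    have := ht (a + -t)
    rw [neg_add_cancel_right] at this
    exact this.symm

theorem memT (hc : D.c = 0) {u : ℚ} (hu : D.χ u = -1) (hu1 : D.χ (1 + u) = 1)
    (hu2 : D.χ (1 - u) = 1) : u ∈ D.T := by
  obtain ⟨-, hU, hW⟩ := D.basic hu
  intro a
  by_cases a0 : a = 0
  · rw [a0, zero_add, D.f0, hU u hu, hc, smul_zero]
  rcases D.hχ a a0 with h | h
  · exact D.S hc hu hu1 h
  rw [hU a h, hc, smul_zero]
  by_cases au : a + u = 0
  · rw [au, D.f0, hc]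
  rcases D.hχ _ au with h' | h'
  · have := D.S hc (u := -u) (a := a + u) (by rw [D.chi_neg, hu])
      (by rwa [← sub_eq_add_neg]) h'
    rw [add_neg_cancel_right, hU a h, hc, smul_zero] at this
    exact this.symm
  · rw [hU _ h', hc, smul_zero]

theorem memT_div (hc : D.c = 0) {A B : ℕ} (hA : D.χ A = -1) (hB : D.χ B = 1)
    (h1 : D.χ (A + B) = 1) (h2 : D.χ (A - B) = 1) : (A : ℚ) ∈ D.T := by
  have B0 := D.ne0 (Or.inl hB)
  have h : (A / B : ℚ) ∈ D.T := by
    apply D.memT hc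
    · rw [D.chi_div, hA, hB]; rfl
    · have : (1 + A / B : ℚ) = (A + B) / B := by field_simp; ring
      rw [this, D.chi_div, h1, hB]; rfl
    · have : (1 - A / B : ℚ) = (B - A) / B := by field_simp
      rw [this, D.chi_div, D.chi_sub, h2, hB]; rfl
  have := D.T.nsmul_mem h B
  rwa [nsmul_eq_mul, mul_div_cancel₀ _ B0] at this

theorem zero_of_two (hc : D.c = 0) (h : D.χ 2 = -1) : ∀ a, D.f a = 0 := by
  obtain ⟨-, hU, hW⟩ := D.basic h
  have hneg : ∀ y, D.f (-y) = D.f y := by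
    intro y
    by_cases y0 : y = 0
    · simp [y0]
    rcases D.hχ y y0 with hy | hy
    · have := D.L5 hc (y := y) (w := -1) hy D.hm (by norm_num; exact h)
      rwa [mul_neg_one] at this
    · rw [hU y hy, hU (-y) (by rw [D.chi_neg, hy]), hc, smul_zero, smul_zero]
  have hs : ∀ y, D.f (y + 1) = - D.f y := by
    intro y
    by_cases y0 : y = 0
    · rw [y0, zero_add, D.f0, D.f1, hc, neg_zero]
    by_cases y1 : y = -1
    · rw [y1, D.fm1, neg_add_cancel, D.f0, hc, neg_zero]
    have := D.fc (-y) (by simpa using y0) (by intro h; apply y1; linarith)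
    rw [hc, hneg, sub_neg_eq_add, add_comm 1 y] at this
    exact eq_neg_of_add_eq_zero_right this
  have h1 : ∀ (n : ℕ) (y : ℚ), D.f (y + n) = D.f y ∨ D.f (y + n) = - D.f y := by
    intro n y
    induction n with
    | zero => left; simp
    | succ n ih =>
      have : y + (n + 1 : ℕ) = (y + n) + 1 := by push_cast; ring
      rw [this, hs]
      rcases ih with ih | ih <;> rw [ih] <;> simp
  have h2 : ∀ (n : ℕ) (y : ℚ), D.f y = 0 → D.f (y + n) = 0 := by
    intro n y hy
    rcases h1 n y with h | h <;> rw [h, hy]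
    simp
  have h3 : ∀ (n : ℕ), ∀ m : ℕ, D.f (m / n) = 0 := by
    intro n
    induction n using Nat.strong_induction_on with
    | _ n ih =>
      intro m
      by_cases n0 : n = 0
      · simp [n0, D.f0, hc]
      have hn : (n : ℚ) ≠ 0 := by exact_mod_cast n0
      have e : (m / n : ℚ) = ((m % n : ℕ) : ℚ) / n + (m / n : ℕ) := by
        field_simp
        exact_mod_cast (Nat.mod_add_div m n).symm
      rw [e]
      apply h2
      by_cases r0 : m % n = 0
      · rw [r0]; simp [D.f0, hc]
      have hr : ((m % n : ℕ) : ℚ) ≠ 0 := by exact_mod_cast r0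
      have := ih (m % n) (Nat.mod_lt _ (Nat.pos_of_ne_zero n0)) n
      rw [← inv_div, D.finv _ (div_ne_zero hn hr), this, neg_zero]
  intro a
  have hpos : ∀ a : ℚ, 0 ≤ a → D.f a = 0 := by
    intro a ha
    have := h3 a.den a.num.toNat
    have e : ((a.num.toNat : ℕ) : ℚ) = a.num := by
      have : ((a.num.toNat : ℕ) : ℤ) = a.num := Int.toNat_of_nonneg (Rat.num_nonneg.mpr ha)
      exact_mod_cast this
    rwa [e, Rat.num_div_den] at this
  rcases le_total 0 a with ha | ha
  · exact hpos a ha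
  · rw [← hneg]; exact hpos _ (by linarith)

theorem chi_small {p q : ℕ}
    (hq : ∀ r : ℕ, r.Prime → r ≠ p → r < q → D.χ r = 1) :
    ∀ k : ℕ, 0 < k → k < q → ¬ p ∣ k → D.χ k = 1 := by
  intro k
  induction k using Nat.strong_induction_on with
  | _ k ih =>
    intro h0 hk hpk
    by_cases k1 : k = 1
    · simp [k1]
    obtain ⟨m, hm⟩ := k.minFac_dvd
    have hr := Nat.minFac_prime k1
    have hrk := Nat.minFac_le h0
    have m0 : 0 < m := by
      rcases Nat.eq_zero_or_pos m with h | h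
      · rw [h] at hm; omega
      · exact h
    have mk : m < k := by
      have := hr.two_le
      nlinarith
    have hrp : k.minFac ≠ p := fun h => hpk (h ▸ k.minFac_dvd)
    have hpm : ¬ p ∣ m := fun h => hpk (by rw [hm]; exact h.mul_left _)
    have e1 := hq _ hr hrp (by omega)
    have e2 := ih m mk m0 (by omega) hpm
    have : (k : ℚ) = (k.minFac : ℚ) * (m : ℚ) := by exact_mod_cast hm
    rw [this, map_mul, e1, e2]; rfl

theorem c_zero_two {q : ℕ} (hqp : q.Prime) (h2 : D.χ 2 = -1) (hq : D.χ q = -1) (hq2 : q ≠ 2)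
    (hs : ∀ k : ℕ, 0 < k → k < q → ¬ 2 ∣ k → D.χ k = 1) : D.c = 0 := by
  have hodd : q % 2 = 1 := hqp.eq_two_or_odd.resolve_left hq2
  have q2 := hqp.two_le
  obtain ⟨c3, hU, hW⟩ := D.basic h2
  have h4 : D.χ 4 = 1 := by
    have : (4 : ℚ) = 2 * 2 := by norm_num
    rw [this, map_mul, h2]; rfl
  by_cases e3 : q = 3
  · subst e3
    have h3 : D.χ 3 = -1 := by exact_mod_cast hq
    have e := D.ft (-1) 2 (by norm_num) (by norm_num) (by norm_num) (by norm_num)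
    have f2 := hU 2 h2
    have fm2 := hU (-2) (by rw [D.chi_neg, h2])
    have f4 := hW 4 h4 (by norm_num; rw [D.chi_neg, h3])
    norm_num [D.chi_neg, h2, h3, D.fm1, f4] at e f2 fm2
    rw [f2] at e
    exact e
  have h3 : D.χ 3 = 1 := by exact_mod_cast hs 3 (by norm_num) (by omega) (by norm_num)
  have h14 : D.χ (1 - 4) = 1 := by norm_num; rw [D.chi_neg, h3]
  have f4 : D.f 4 = D.c := D.P1 (x := 2) h4 h14 h2 (by norm_num [D.hm])
    (by norm_num [D.chi_neg, h2])
  by_cases e5 : q = 5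
  · subst e5
    have h5 : D.χ 5 = -1 := by exact_mod_cast hq
    rw [← f4]
    exact D.P2 (x := -1) h4 h14 D.hm (by norm_num [h2]) (by norm_num [D.chi_neg, h5])
  have key : ∀ k : ℕ, k < q → k % 4 = 2 → D.χ k = -1 := by
    intro k hk h
    obtain ⟨m, rfl⟩ : ∃ m, k = 2 * m := ⟨k / 2, by omega⟩
    push_cast
    rw [map_mul, h2, hs m (by omega) (by omega) (by omega)]; rfl
  apply D.c_of_neg
  nth_rw 1 [← f4]
  rcases (by omega : q % 4 = 3 ∨ q % 4 = 1) with h | h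
  · apply D.P3 (x := q) h4 h14 hq
    · rw [D.chi_sub]
      have := key (q - 1) (by omega) (by omega)
      rwa [Nat.cast_sub (by omega), Nat.cast_one] at this
    · have := hs (q - 4) (by omega) (by omega) (by omega)
      rwa [Nat.cast_sub (by omega)] at this
  · have q9 : q ≠ 9 := by rintro rfl; norm_num at hqp
    apply D.P3 (x := q / 3) h4 h14
    · rw [D.chi_div, hq, h3]; rfl
    · have := key (q - 3) (by omega) (by omega)
      rw [Nat.cast_sub (by omega)] at this
      have e : (1 - q / 3 : ℚ) = - ((q - (3 : ℕ)) / 3) := by push_cast; field_simp; ring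
      rw [e, D.chi_neg, D.chi_div, this, h3]; rfl
    · have := hs (q - 12) (by omega) (by omega) (by omega)
      rw [Nat.cast_sub (by omega)] at this
      have e : (q / 3 - 4 : ℚ) = ((q - (12 : ℕ)) / 3) := by push_cast; field_simp; ring
      rw [e, D.chi_div, this, h3]; rfl

theorem c_zero_odd {p q : ℕ} (hpp : p.Prime) (hqp : q.Prime) (hp2 : p ≠ 2) (hpq : p < q)
    (hp : D.χ p = -1) (hq : D.χ q = -1)
    (hs : ∀ k : ℕ, 0 < k → k < q → ¬ p ∣ k → D.χ k = 1) : D.c = 0 := by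
  have p3 : 3 ≤ p := by have := hpp.two_le; omega
  have h2 : D.χ 2 = 1 := by
    exact_mod_cast hs 2 (by norm_num) (by omega) (fun h => by
      have := Nat.le_of_dvd (by norm_num) h; omega)
  have hpq' : ¬ p ∣ q := fun h => by
    rcases (Nat.dvd_prime hqp).mp h with h | h <;> omega
  have hp2' : ¬ p ∣ 2 := fun h => by
    have := Nat.le_of_dvd (by norm_num) h; omega
  -- the multiplier
  have hk : ∃ k : ℕ, 0 < k ∧ ¬ p ∣ k ∧ p * k < q ∧ q < 2 * (p * k) := by
    have d1 := Nat.div_add_mod q p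
    have d2 := Nat.mod_lt q (by omega : 0 < p)
    have d3 : q % p ≠ 0 := fun h => hpq' (Nat.dvd_of_mod_eq_zero h)
    set m := q / p with hm
    have m1 : 1 ≤ m := Nat.div_pos hpq.le (by omega)
    by_cases hpm : p ∣ m
    · have m3 : 3 ≤ m := p3.trans (Nat.le_of_dvd m1 hpm)
      obtain ⟨j, hj⟩ : ∃ j, m = j + 1 := ⟨m - 1, by omega⟩
      refine ⟨j, by omega, fun h => ?_, ?_, ?_⟩
      · rw [hj] at hpm
        have := (Nat.dvd_add_right h).mp hpm
        have := Nat.le_of_dvd (by norm_num) this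
        omega
      · rw [hj, Nat.mul_add] at d1; omega
      · rw [hj] at d1
        have : 2 ≤ j := by omega
        nlinarith
    · refine ⟨m, m1, hpm, by omega, ?_⟩
      nlinarith
  obtain ⟨k, k0, hpk, k1, k2⟩ := hk
  have kq : k < q := by nlinarith
  have hB : D.χ ((2 * (p * k) - q : ℕ) : ℚ) = 1 := by
    apply hs _ (by omega) (by omega)
    intro h
    have : p ∣ 2 * (p * k) := (Dvd.intro _ rfl : p ∣ p * k).mul_left _
    exact hpq' ((Nat.dvd_sub_iff_right k2.le this).mp h)
  have hqB : D.χ ((2 * (q - p * k) : ℕ) : ℚ) = 1 := by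
    have := hs (q - p * k) (by omega) (by omega) (fun h => hpq'
      ((Nat.dvd_sub_iff_left k1.le (Dvd.intro _ rfl : p ∣ p * k)).mp h))
    push_cast at this ⊢
    rw [map_mul, h2, this]; rfl
  have hqB' : D.χ ((2 * (p * k) : ℕ) : ℚ) = -1 := by
    push_cast
    rw [map_mul, map_mul, h2, hp, hs k k0 kq hpk]; rfl
  rw [Nat.cast_sub k2.le] at hB
  rw [Nat.cast_mul, Nat.cast_sub k1.le] at hqB
  push_cast at hB hqB hqB'
  have B0 := D.ne0 (Or.inl hB)
  rw [← D.fm1]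
  symm
  apply D.P1 (x := q / (2 * (p * k) - q)) D.hm (by norm_num [h2])
  · rw [D.chi_div, hq, hB]; rfl
  · have : (1 - q / (2 * (p * k) - q) : ℚ) = - ((2 * (q - p * k)) / (2 * (p * k) - q)) := by
      rw [← neg_div, eq_div_iff B0, sub_mul, div_mul_cancel₀ _ B0]; ring
    rw [this, D.chi_neg, D.chi_div, hqB, hB]; rfl
  · have : (q / (2 * (p * k) - q) - -1 : ℚ) = (2 * (p * k)) / (2 * (p * k) - q) := by
      rw [eq_div_iff B0, sub_mul, div_mul_cancel₀ _ B0]; ring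
    rw [this, D.chi_div, hqB', hB]; rfl

theorem T_odd {p q : ℕ} (hpp : p.Prime) (hqp : q.Prime) (hp2 : p ≠ 2) (hpq : p < q)
    (hp : D.χ p = -1) (hq : D.χ q = -1) (hc : D.c = 0)
    (hs : ∀ k : ℕ, 0 < k → k < q → ¬ p ∣ k → D.χ k = 1) : (1 : ℚ) ∈ D.T := by
  have p3 : 3 ≤ p := by have := hpp.two_le; omega
  have h2 : D.χ 2 = 1 := by
    exact_mod_cast hs 2 (by norm_num) (by omega) (fun h => by
      have := Nat.le_of_dvd (by norm_num) h; omega)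
  have hpq' : ¬ p ∣ q := fun h => by
    rcases (Nat.dvd_prime hqp).mp h with h | h <;> omega
  have hpo : p % 2 = 1 := hpp.eq_two_or_odd.resolve_left hp2
  have hqo : q % 2 = 1 := hqp.eq_two_or_odd.resolve_left (by omega)
  have heven : ∀ k : ℕ, 0 < k → k < 2 * q → k % 2 = 0 → ¬ p ∣ k → D.χ k = 1 := by
    intro k h0 hk he hd
    obtain ⟨m, rfl⟩ : ∃ m, k = 2 * m := ⟨k / 2, by omega⟩
    push_cast
    rw [map_mul, h2, hs m (by omega) (by omega) (fun h => hd (h.mul_left _))]; rfl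
  have nd : ∀ k : ℕ, 0 < k → k < p → ¬ p ∣ k := fun k h0 hk h => by
    have := Nat.le_of_dvd h0 h; omega
  have pT : (p : ℚ) ∈ D.T := by
    apply D.memT hc hp
    · have := heven (p + 1) (by omega) (by omega) (by omega) (fun h =>
        nd 1 (by omega) (by omega) ((Nat.dvd_add_right (dvd_refl p)).mp h))
      push_cast at this
      rwa [add_comm]
    · have := hs (p - 1) (by omega) (by omega) (nd _ (by omega) (by omega))
      rw [Nat.cast_sub (by omega)] at this
      rw [D.chi_sub]
      exact_mod_cast this
  have qT : (q : ℚ) ∈ D.T := by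
    have main : ∀ B : ℕ, B < q → D.χ B = 1 → B % 2 = 1 → ¬ p ∣ q + B → ¬ p ∣ q - B →
        (q : ℚ) ∈ D.T := by
      intro B hB hB1 ho d1 d2
      apply D.memT_div hc hq hB1
      · exact_mod_cast heven (q + B) (by omega) (by omega) (by omega) d1
      · have := hs (q - B) (by omega) (by omega) d2
        rwa [Nat.cast_sub hB.le] at this
    by_cases e3 : p = 3
    · subst e3
      have h3 : D.χ 3 = -1 := by exact_mod_cast hp
      have h9 : D.χ 9 = 1 := by
        have : (9 : ℚ) = 3 * 3 := by norm_num
        rw [this, map_mul, h3]; rfl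
      have h4 : D.χ 4 = 1 := by
        have : (4 : ℚ) = 2 * 2 := by norm_num
        rw [this, map_mul, h2]; rfl
      by_cases e5 : q = 5
      · subst e5
        apply D.memT_div hc hq (B := 4) (by exact_mod_cast h4) <;> norm_num [h9]
      by_cases e7 : q = 7
      · subst e7
        have h5 : D.χ 5 = 1 := by exact_mod_cast hs 5 (by norm_num) (by omega) (by norm_num)
        apply D.memT_div hc hq (B := 2) (by exact_mod_cast h2) <;> norm_num [h9, h5]
      have q9 : q ≠ 9 := by rintro rfl; norm_num at hqp
      exact main 9 (by omega) (by exact_mod_cast h9) (by norm_num) (by omega) (by omega)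
    have p4 : p ≠ 4 := by omega
    by_cases d1 : p ∣ q + 1 ∨ p ∣ q - 1
    · have h3 := hs 3 (by norm_num) (by omega) (nd 3 (by omega) (by omega))
      refine main 3 (by omega) h3 (by norm_num) ?_ ?_
      · intro h
        rcases d1 with d | d
        · have := Nat.dvd_sub h d
          rw [show q + 3 - (q + 1) = 2 by omega] at this
          exact nd 2 (by omega) (by omega) this
        · have := Nat.dvd_sub h d
          rw [show q + 3 - (q - 1) = 4 by omega] at this
          exact nd 4 (by omega) (by omega) this
      · intro h
        rcases d1 with d | d
        · have := Nat.dvd_sub d h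
          rw [show q + 1 - (q - 3) = 4 by omega] at this
          exact nd 4 (by omega) (by omega) this
        · have := Nat.dvd_sub d h
          rw [show q - 1 - (q - 3) = 2 by omega] at this
          exact nd 2 (by omega) (by omega) this
    · push Not at d1
      exact main 1 (by omega) (by simp) (by norm_num) d1.1 d1.2
  have hcop : IsCoprime (p : ℤ) (q : ℤ) :=
    Nat.isCoprime_iff_coprime.mpr ((Nat.coprime_primes hpp hqp).mpr hpq.ne)
  obtain ⟨s, t, hst⟩ := hcop
  have := D.T.add_mem (D.T.zsmul_mem pT s) (D.T.zsmul_mem qT t)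
  rw [zsmul_eq_mul, zsmul_eq_mul] at this
  have e : (s * p + t * q : ℚ) = 1 := by exact_mod_cast hst
  rwa [e] at this

theorem final {p q : ℕ} (hp : p.Prime) (hq : q.Prime) (hpq : p ≠ q)
    (hχp : D.χ p = -1) (hχq : D.χ q = -1) (a : ℚ) (t : ℤ) : D.f a = D.f (a + t) := by
  have ex : ∃ p : ℕ, p.Prime ∧ D.χ p = -1 := ⟨p, hp, hχp⟩
  obtain ⟨P, hP, hPm⟩ : ∃ P : ℕ, (P.Prime ∧ D.χ P = -1) ∧
      ∀ r < P, ¬ (r.Prime ∧ D.χ r = -1) :=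
    ⟨Nat.find ex, Nat.find_spec ex, fun r hr => Nat.find_min ex hr⟩
  have ex2 : ∃ q : ℕ, q.Prime ∧ q ≠ P ∧ D.χ q = -1 := by
    by_cases h : p = P
    · exact ⟨q, hq, fun h' => hpq (h.trans h'.symm), hχq⟩
    · exact ⟨p, hp, h, hχp⟩
  obtain ⟨Q, hQ, hQm⟩ : ∃ Q : ℕ, (Q.Prime ∧ Q ≠ P ∧ D.χ Q = -1) ∧
      ∀ r < Q, ¬ (r.Prime ∧ r ≠ P ∧ D.χ r = -1) :=
    ⟨Nat.find ex2, Nat.find_spec ex2, fun r hr => Nat.find_min ex2 hr⟩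
  have hPQ : P < Q := by
    rcases lt_trichotomy P Q with h | h | h
    · exact h
    · exact absurd h.symm hQ.2.1
    · exact absurd ⟨hQ.1, hQ.2.2⟩ (hPm Q h)
  have hs := D.chi_small (p := P) (q := Q) (fun r hr hrP hrQ =>
    (D.hχ r (by exact_mod_cast hr.ne_zero)).resolve_right (fun h => hQm r hrQ ⟨hr, hrP, h⟩))
  by_cases h2 : P = 2
  · subst h2
    have h2 : D.χ 2 = -1 := by exact_mod_cast hP.2
    have hc := D.c_zero_two hQ.1 h2 hQ.2.2 hQ.2.1 hs
    rw [D.zero_of_two hc h2, D.zero_of_two hc h2]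
  · have hc := D.c_zero_odd hP.1 hQ.1 h2 hPQ hP.2 hQ.2.2 hs
    have h1 := D.T_odd hP.1 hQ.1 h2 hPQ hP.2 hQ.2.2 hc hs
    have := D.T.zsmul_mem h1 t
    rw [zsmul_one] at this
    exact (this a).symm

end Dat
end St17


namespace St17

theorem rp_add_aux (s t : FreeRP ℚ) :
    (Submodule.Quotient.mk (s + t) : RP' ℚ) =
      (Submodule.Quotient.mk s : RP' ℚ) + (Submodule.Quotient.mk t : RP' ℚ) := rfl

/-- the quotient map onto `RP'` -/
def piRP : FreeRP ℚ →ₗ[RF ℚ] RP' ℚ where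
  toFun s := (Submodule.Quotient.mk s :
    FreeRP ℚ ⧸ Submodule.span (RF ℚ) ({gen ℚ 1} ∪ ftRels ℚ ∪ minusRels ℚ ∪ invRels ℚ))
  map_add' _ _ := rfl
  map_smul' _ _ := rfl

theorem piRP_zero {w : FreeRP ℚ}
    (h : w ∈ ({gen ℚ 1} ∪ ftRels ℚ ∪ minusRels ℚ ∪ invRels ℚ : Set (FreeRP ℚ))) :
    piRP w = 0 :=
  (Submodule.Quotient.mk_eq_zero _).mpr (Submodule.subset_span h)

theorem piRP_gen (x : ℚˣ) : piRP (gen ℚ x) = rp ℚ x := rfl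

/-- the localization map -/
def locRP : RP' ℚ →ₗ[RF ℚ] Loc2 ℚ (RP' ℚ) where
  toFun m := toLoc2 ℚ m
  map_add' := (LocalizedModule.mkLinearMap (Submonoid.powers (2 : RF ℚ)) (RP' ℚ)).map_add
  map_smul' := (LocalizedModule.mkLinearMap (Submonoid.powers (2 : RF ℚ)) (RP' ℚ)).map_smul

/-- the quotient map to coinvariants -/
def chiL (χ : SqCl ℚ →* ℤˣ) : Loc2 ℚ (RP' ℚ) →ₗ[RF ℚ] ChiQuot ℚ χ (Loc2 ℚ (RP' ℚ)) where
  toFun m := mkChi ℚ χ m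
  map_add' _ _ := rfl
  map_smul' _ _ := rfl

/-- the total map -/
def tot (χ : SqCl ℚ →* ℤˣ) : RP' ℚ →ₗ[RF ℚ] ChiQuot ℚ χ (Loc2 ℚ (RP' ℚ)) :=
  (chiL χ).comp locRP

theorem tot_apply (χ : SqCl ℚ →* ℤˣ) (m : RP' ℚ) :
    tot χ m = mkChi ℚ χ (toLoc2 ℚ m) := rfl

theorem tot_cls (χ : SqCl ℚ →* ℤˣ) (a : ℚˣ) (m : RP' ℚ) :
    tot χ (cls ℚ a • m) = (χ (sqc ℚ a) : ℤ) • tot χ m := by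
  have h : chiL χ (cls ℚ a • locRP m - (χ (sqc ℚ a) : ℤ) • locRP m) = 0 :=
    (Submodule.Quotient.mk_eq_zero (chiSub ℚ χ (Loc2 ℚ (RP' ℚ)))).mpr
      (Submodule.subset_span ⟨a, locRP m, rfl⟩)
  rw [map_sub, map_zsmul, sub_eq_zero] at h
  rw [← show chiL χ (locRP m) = tot χ m from rfl, ← h]
  show chiL χ (locRP _) = _
  rw [map_smul]

theorem two_bij : Function.Bijective (fun m : Loc2 ℚ (RP' ℚ) => (2 : RF ℚ) • m) := by
  have h := IsLocalizedModule.map_units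
    (LocalizedModule.mkLinearMap (Submonoid.powers (2 : RF ℚ)) (RP' ℚ))
    ⟨2, Submonoid.mem_powers 2⟩
  exact (Module.End.isUnit_iff _).mp h

theorem two_tf (χ : SqCl ℚ →* ℤˣ) (m : ChiQuot ℚ χ (Loc2 ℚ (RP' ℚ)))
    (h : (2 : ℤ) • m = 0) : m = 0 := by
  obtain ⟨n, rfl⟩ : ∃ n, chiL χ n = m :=
    Submodule.Quotient.mk_surjective (chiSub ℚ χ (Loc2 ℚ (RP' ℚ))) m
  let E := LinearEquiv.ofBijective
    (LinearMap.lsmul (RF ℚ) (Loc2 ℚ (RP' ℚ)) (2 : RF ℚ)) two_bij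
  have hE : ∀ x, E x = (2 : RF ℚ) • x := fun x => rfl
  have hmap : (chiSub ℚ χ (Loc2 ℚ (RP' ℚ))).map (E.symm : _ →ₗ[RF ℚ] _) ≤
      chiSub ℚ χ (Loc2 ℚ (RP' ℚ)) := by
    unfold chiSub
    rw [Submodule.map_span, Submodule.span_le]
    rintro _ ⟨w, ⟨a, k, rfl⟩, rfl⟩
    apply Submodule.subset_span
    refine ⟨a, E.symm k, ?_⟩
    rw [map_sub, map_smul, map_zsmul]
    rfl
  have h2 : (2 : RF ℚ) • n ∈ chiSub ℚ χ (Loc2 ℚ (RP' ℚ)) := by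
    rw [← map_zsmul] at h
    have := (Submodule.Quotient.mk_eq_zero (chiSub ℚ χ (Loc2 ℚ (RP' ℚ)))).mp h
    rwa [two_smul] at this ⊢
  have h3 : n ∈ chiSub ℚ χ (Loc2 ℚ (RP' ℚ)) := by
    apply hmap
    refine ⟨_, h2, ?_⟩
    rw [← hE]
    exact E.symm_apply_apply n
  exact (Submodule.Quotient.mk_eq_zero (chiSub ℚ χ (Loc2 ℚ (RP' ℚ)))).mpr h3

/-- the character as a map on `ℚ` -/
def chi0 (χ : SqCl ℚ →* ℤˣ) : ℚ →*₀ ℤ where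
  toFun x := if h : x ≠ 0 then (χ (sqc ℚ (U ℚ x h)) : ℤ) else 0
  map_zero' := by simp
  map_one' := by
    have : U ℚ 1 one_ne_zero = 1 := Units.ext rfl
    simp [this]
  map_mul' x y := by
    by_cases hx : x = 0
    · simp [hx]
    by_cases hy : y = 0
    · simp [hy]
    have : U ℚ (x * y) (mul_ne_zero hx hy) = U ℚ x hx * U ℚ y hy := Units.ext rfl
    simp [hx, hy, this]

theorem chi0_apply (χ : SqCl ℚ →* ℤˣ) (x : ℚ) (h : x ≠ 0) :
    chi0 χ x = (χ (sqc ℚ (U ℚ x h)) : ℤ) := by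
  show (if h : x ≠ 0 then (χ (sqc ℚ (U ℚ x h)) : ℤ) else 0) = _
  rw [dif_pos h]

theorem rpc_ne (c : RP' ℚ) (x : ℚ) (h : x ≠ 0) : rpc ℚ c x = rp ℚ (U ℚ x h) := dif_pos h

theorem chi0_sqv (χ : SqCl ℚ →* ℤˣ) (x : ℚ) (h : x ≠ 0) (hx : χ (sqv ℚ x) = -1) :
    chi0 χ x = -1 := by
  rw [chi0_apply χ x h]
  unfold sqv at hx
  rw [dif_pos h] at hx
  rw [hx]; rfl

/-- the abstract data -/
def dat (c : RP' ℚ)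
    (hc : ∀ (x : ℚˣ) (hx : (x : ℚ) ≠ 1),
      c = rp ℚ x + rp ℚ (U ℚ (1 - (x : ℚ)) (one_sub_ne hx)))
    (χ : SqCl ℚ →* ℤˣ) (hχm1 : χ (sqc ℚ (-1)) = 1) :
    Dat (ChiQuot ℚ χ (Loc2 ℚ (RP' ℚ))) where
  χ := chi0 χ
  hχ x hx := by
    rw [chi0_apply χ x hx]
    rcases Int.units_eq_one_or (χ (sqc ℚ (U ℚ x hx))) with h | h <;> simp [h]
  hm := by
    rw [chi0_apply χ (-1) (by norm_num)]
    have : U ℚ (-1) (by norm_num) = -1 := Units.ext rfl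
    rw [this, hχm1]; rfl
  h2 := two_tf χ
  c := tot χ c
  f x := tot χ (rpc ℚ c x)
  f0 := by simp [rpc]
  f1 := by
    rw [rpc_ne c 1 one_ne_zero, ← piRP_gen]
    have : U ℚ 1 one_ne_zero = 1 := Units.ext rfl
    rw [this, piRP_zero (by simp), map_zero]
  finv x hx := by
    rw [rpc_ne c _ hx, rpc_ne c _ (inv_ne_zero hx)]
    have : U ℚ x⁻¹ (inv_ne_zero hx) = (U ℚ x hx)⁻¹ := Units.ext rfl
    rw [this, ← piRP_gen, ← piRP_gen]
    have h := piRP_zero (w := gen ℚ (U ℚ x hx)⁻¹ + gen ℚ (U ℚ x hx)) (Or.inr ⟨_, rfl⟩)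
    rw [map_add] at h
    rw [eq_neg_of_add_eq_zero_left h, map_neg]
  fc x hx hx1 := by
    rw [rpc_ne c _ hx, rpc_ne c _ (sub_ne_zero.mpr (Ne.symm hx1)), ← map_add]
    exact congrArg _ (hc (U ℚ x hx) hx1).symm
  ft x y hx hx1 hy hy1 := by
    have a1 : 1 - x ≠ 0 := sub_ne_zero.mpr (Ne.symm hx1)
    have a2 : 1 - y ≠ 0 := sub_ne_zero.mpr (Ne.symm hy1)
    have a3 : x⁻¹ - 1 ≠ 0 := inv_sub_one_ne (x := U ℚ x hx) hx1
    have a4 : 1 - x⁻¹ ≠ 0 := one_sub_inv_ne (x := U ℚ x hx) hx1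
    have a5 : 1 - y⁻¹ ≠ 0 := one_sub_inv_ne (x := U ℚ y hy) hy1
    have h := piRP_zero (w := FT ℚ (U ℚ x hx) (U ℚ y hy) hx1 hy1)
      (Or.inl (Or.inl (Or.inr ⟨_, _, _, _, rfl⟩)))
    have h' := congrArg (tot χ) h
    unfold FT at h'
    simp only [map_add, map_sub, map_smul piRP, tot_cls, map_zero, piRP_gen] at h'
    rw [rpc_ne c _ hx, rpc_ne c _ hy, rpc_ne c _ (div_ne_zero hy hx),
      rpc_ne c _ (div_ne_zero a4 a5), rpc_ne c _ (div_ne_zero a1 a2),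
      chi0_apply χ _ hx, chi0_apply χ _ a3, chi0_apply χ _ a1]
    have e : U ℚ (y / x) (div_ne_zero hy hx) = U ℚ y hy * (U ℚ x hx)⁻¹ :=
      Units.ext (div_eq_mul_inv y x)
    rw [e]
    exact h'

end St17

end

/-- Let `χ : G_ℚ → {±1}` be a character with `χ(-1) = 1`, and suppose
that `supp(χ) = {p prime : χ(p) = -1}` contains at least two distinct primes.  Then
`[a]_χ = [a + t]_χ` in `(RP′(ℚ)[1/2])_χ` for all `a ∈ ℚ` and all `t ∈ ℤ`, where by
convention `[0] := C_ℚ` (the common value of `[x] + [1-x]` over `x ∈ ℚ^× \ {1}`). -/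
theorem statement17
    (c : RP' ℚ)
    (hc : ∀ (x : ℚˣ) (hx : (x : ℚ) ≠ 1),
      c = rp ℚ x + rp ℚ (U ℚ (1 - (x : ℚ)) (one_sub_ne hx)))
    (χ : SqCl ℚ →* ℤˣ) (hχm1 : χ (sqc ℚ (-1)) = 1)
    (p q : ℕ) (hp : p.Prime) (hq : q.Prime) (hpq : p ≠ q)
    (hχp : χ (sqv ℚ (p : ℚ)) = -1) (hχq : χ (sqv ℚ (q : ℚ)) = -1)
    (a : ℚ) (t : ℤ) :
    mkChi ℚ χ (toLoc2 ℚ (rpc ℚ c a) : Loc2 ℚ (RP' ℚ)) =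
      mkChi ℚ χ (toLoc2 ℚ (rpc ℚ c (a + (t : ℚ)))) := by
  exact (St17.dat c hc χ hχm1).final hp hq hpq
    (St17.chi0_sqv χ _ (by exact_mod_cast hp.ne_zero) hχp)
    (St17.chi0_sqv χ _ (by exact_mod_cast hq.ne_zero) hχq) a t
end

section
/- Let χ : G_ℚ → {±1} be a character with χ(−1) = 1 and let supp(χ) := {p prime : χ(p) = −1}. If supp(χ) contains at least two distinct primes, then (RP′(ℚ)[1/2])_χ = 0. -/
open scoped Classical

structure Dat {A : Type} [AddCommGroup A] (X : ℚ → ℤ) (f : ℚ → A) : Prop where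
  h2 : ∀ a : A, a + a = 0 → a = 0
  Xm : ∀ x y, X (x * y) = X x * X y
  X0 : X 0 = 0
  Xpm : ∀ x, x ≠ 0 → X x = 1 ∨ X x = -1
  Xn : X (-1) = 1
  f1 : f 1 = 0
  fi : ∀ x, x ≠ 0 → f x⁻¹ = - f x
  ft : ∀ x y, x ≠ 0 → y ≠ 0 → x ≠ 1 → y ≠ 1 →
    f x - f y + X x • f (y / x) - X (x⁻¹ - 1) • f ((1 - x⁻¹) / (1 - y⁻¹))
      + X (1 - x) • f ((1 - x) / (1 - y)) = 0

namespace Dat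

variable {A : Type} [AddCommGroup A] {X : ℚ → ℤ} {f : ℚ → A}

theorem X1 (D : Dat X f) : X 1 = 1 := by
  have := D.Xm (-1) (-1)
  rw [D.Xn] at this
  norm_num at this
  exact this

theorem neg (D : Dat X f) (x : ℚ) : X (-x) = X x := by
  have := D.Xm (-1) x
  rw [D.Xn] at this
  simpa using this

theorem subc (D : Dat X f) (x y : ℚ) : X (x - y) = X (y - x) := by
  rw [← D.neg, neg_sub]

theorem sq (D : Dat X f) {x : ℚ} (h : x ≠ 0) : X x * X x = 1 := by
  rcases D.Xpm x h with h | h <;> rw [h] <;> rfl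

theorem inv (D : Dat X f) (x : ℚ) : X x⁻¹ = X x := by
  by_cases h : x = 0
  · simp [h]
  · have h1 := D.Xm x x⁻¹
    rw [mul_inv_cancel₀ h, D.X1] at h1
    rcases D.Xpm x h with h | h <;> rw [h] at h1 ⊢ <;> linarith

theorem div (D : Dat X f) (x y : ℚ) : X (x / y) = X x * X y := by
  rw [div_eq_mul_inv, D.Xm, D.inv]

theorem ne0 (D : Dat X f) {x : ℚ} (h : X x = 1 ∨ X x = -1) : x ≠ 0 := by
  rintro rfl
  rw [D.X0] at h
  omega

theorem ne1 (D : Dat X f) {x : ℚ} (h : X x = -1) : x ≠ 1 := by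
  rintro rfl
  rw [D.X1] at h
  omega

theorem ft' (D : Dat X f) {x y : ℚ} (hx : x ≠ 0) (hy : y ≠ 0) (hx1 : x ≠ 1) (hy1 : y ≠ 1) :
    f x - f y + X x • f (y / x) - (X x * X (1 - x)) • f (y * (1 - x) / (x * (1 - y)))
      + X (1 - x) • f ((1 - x) / (1 - y)) = 0 := by
  have h := D.ft x y hx hy hx1 hy1
  have a1 : 1 - x ≠ 0 := sub_ne_zero.2 hx1.symm
  have a2 : 1 - y ≠ 0 := sub_ne_zero.2 hy1.symm
  have a3 : y - 1 ≠ 0 := sub_ne_zero.2 hy1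
  have e1 : x⁻¹ - 1 = (1 - x) / x := by field_simp
  have e2 : (1 - x⁻¹) / (1 - y⁻¹) = y * (1 - x) / (x * (1 - y)) := by
    have : 1 - y⁻¹ = (y - 1) / y := by field_simp
    rw [this]
    field_simp
    ring
  rw [e2, e1, D.div, mul_comm (X (1 - x)) (X x)] at h
  exact h

theorem anti (D : Dat X f) {x y : ℚ} (hx : x ≠ 0) (hy : y ≠ 0) (hx1 : x ≠ 1) (hy1 : y ≠ 1) :
    (X x - X y) • f (y / x)
      - (X x * X (1 - x) - X y * X (1 - y)) • f (y * (1 - x) / (x * (1 - y)))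
      + (X (1 - x) - X (1 - y)) • f ((1 - x) / (1 - y)) = 0 := by
  have h1 := D.ft' hx hy hx1 hy1
  have h2 := D.ft' hy hx hy1 hx1
  have a1 : 1 - x ≠ 0 := sub_ne_zero.2 hx1.symm
  have a2 : 1 - y ≠ 0 := sub_ne_zero.2 hy1.symm
  have e1 : f (x / y) = - f (y / x) := by
    rw [← D.fi _ (div_ne_zero hy hx), inv_div]
  have e2 : f ((1 - y) / (1 - x)) = - f ((1 - x) / (1 - y)) := by
    rw [← D.fi _ (div_ne_zero a1 a2), inv_div]
  have e3 : f (x * (1 - y) / (y * (1 - x))) = - f (y * (1 - x) / (x * (1 - y))) := by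
    rw [← D.fi _ (div_ne_zero (mul_ne_zero hy a1) (mul_ne_zero hx a2)), inv_div]
  rw [e1, e2, e3] at h2
  have := congrArg₂ (· + ·) h1 h2
  simp only [add_zero] at this
  rw [← this]
  module

theorem C (D : Dat X f) {x y : ℚ} (hx : x ≠ 0) (hy : y ≠ 0) (hx1 : x ≠ 1) (hy1 : y ≠ 1) :
    f x + f (1 - x) = f y + f (1 - y) := by
  have a1 : 1 - x ≠ 0 := sub_ne_zero.2 hx1.symm
  have a2 : 1 - y ≠ 0 := sub_ne_zero.2 hy1.symm
  have h1 := D.ft' hx hy hx1 hy1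
  have h2 := D.ft' a2 a1 (by intro h; apply hy; linarith) (by intro h; apply hx; linarith)
  have h3 := D.anti hx hy hx1 hy1
  have e : (1 - x) * (1 - (1 - y)) / ((1 - y) * (1 - (1 - x)))
      = y * (1 - x) / (x * (1 - y)) := by
    rw [sub_sub_cancel, sub_sub_cancel, mul_comm (1 - x), mul_comm (1 - y)]
  rw [e, sub_sub_cancel, sub_sub_cancel] at h2
  have : f x + f (1 - x) - (f y + f (1 - y)) = 0 := by
    have h4 := congrArg₂ (· - ·) (congrArg₂ (· - ·) h1 h2) h3
    simp only [sub_zero] at h4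
    rw [← h4]
    module
  exact sub_eq_zero.1 this

theorem two (D : Dat X f) {a b : A} (h : a + a = b + b) : a = b := by
  apply sub_eq_zero.1
  apply D.h2
  rw [← sub_eq_zero] at h
  rw [← h]
  abel

theorem L1 (D : Dat X f) {z w : ℚ} (hz : X z = -1) (hw : X w = -1) :
    X (1 - z) • f z = X (1 - w) • f w := by
  by_cases hzw : z = w
  · rw [hzw]
  have z0 := D.ne0 (Or.inr hz)
  have w0 := D.ne0 (Or.inr hw)
  have z1 : z - 1 ≠ 0 := sub_ne_zero.2 (D.ne1 hz)
  have w1 : w - 1 ≠ 0 := sub_ne_zero.2 (D.ne1 hw)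
  have d : w - z ≠ 0 := sub_ne_zero.2 (Ne.symm hzw)
  have ex : 1 - (z - 1) / (w - 1) = (w - z) / (w - 1) := by field_simp; ring
  have ey : 1 - (w * (z - 1)) / (z * (w - 1)) = (w - z) / (z * (w - 1)) := by field_simp; ring
  have h := D.anti (x := (z - 1) / (w - 1)) (y := (w * (z - 1)) / (z * (w - 1)))
    (div_ne_zero z1 w1) (div_ne_zero (mul_ne_zero w0 z1) (mul_ne_zero z0 w1))
    (by intro h; rw [h, sub_self] at ex; exact div_ne_zero d w1 ex.symm)
    (by intro h; rw [h, sub_self] at ey; exact div_ne_zero d (mul_ne_zero z0 w1) ey.symm)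
  rw [ex, ey] at h
  have e1 : (w - z) / (w - 1) / ((w - z) / (z * (w - 1))) = z := by field_simp
  have e2 : (w * (z - 1)) / (z * (w - 1)) * ((w - z) / (w - 1))
      / ((z - 1) / (w - 1) * ((w - z) / (z * (w - 1)))) = w := by field_simp
  rw [e1, e2] at h
  simp only [D.div, D.Xm, hz, hw] at h
  rw [D.subc 1 z, D.subc 1 w]
  rcases D.Xpm _ z1 with h1 | h1 <;> rcases D.Xpm _ w1 with h3 | h3 <;>
    rcases D.Xpm _ d with h4 | h4 <;> rw [h1, h3] <;> rw [h1, h3, h4] at h <;>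
    norm_num at h <;> apply D.two <;> apply sub_eq_zero.1 <;> 
    first
    | (rw [← h]; module)
    | (rw [← neg_eq_zero, ← h]; module)

/-- bundled constant -/
def IsC (X : ℚ → ℤ) (f : ℚ → A) (c : A) : Prop := ∀ z, X z = -1 → f z = X (1 - z) • c

theorem exC (D : Dat X f) {z0 : ℚ} (h0 : X z0 = -1) : ∃ c, IsC X f c := by
  refine ⟨X (1 - z0) • f z0, fun z hz => ?_⟩
  rw [D.L1 h0 hz, smul_smul, D.sq (sub_ne_zero.2 (D.ne1 hz).symm), one_smul]

theorem R (D : Dat X f) {c : A} (hc : IsC X f c) {y y' : ℚ} (hy : X y = 1) (hy' : X y' = 1)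
    (hy1 : y ≠ 1) (h : X (1 - y' * (1 - y)) = -1) : f y' = X (1 - y) • f y - c := by
  have y0 := D.ne0 (Or.inl hy)
  have y'0 := D.ne0 (Or.inl hy')
  have a2 : 1 - y ≠ 0 := sub_ne_zero.2 hy1.symm
  have y'1 : 1 - y' ≠ 0 := by
    intro h1
    have : y' = 1 := by linarith
    rw [this, one_mul, sub_sub_cancel] at h
    omega
  obtain ⟨x, hx⟩ : ∃ x, x = 1 - y' * (1 - y) := ⟨_, rfl⟩
  rw [← hx] at h
  have x0 := D.ne0 (Or.inr h)
  have ex : 1 - x = y' * (1 - y) := by rw [hx]; ring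
  have ft := D.ft' x0 y0 (D.ne1 h) hy1
  have e1 : (1 - x) / (1 - y) = y' := by rw [ex]; field_simp
  have e2 : y * (1 - x) / (x * (1 - y)) = y * y' / x := by rw [ex]; field_simp
  rw [e1, e2, hc x h, hc (y / x) (by rw [D.div, hy, h]; rfl),
    hc (y * y' / x) (by rw [D.div, D.Xm, hy, hy', h]; rfl)] at ft
  have e3 : 1 - y / x = (1 - y) * (1 - y') / x := by
    field_simp; rw [hx]; ring
  have e4 : 1 - y * y' / x = (1 - y') / x := by
    field_simp; rw [hx]; ring
  rw [e3, e4, ex] at ft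
  simp only [D.div, D.Xm, hy', h] at ft
  rcases D.Xpm _ a2 with h1 | h1 <;> rcases D.Xpm _ y'1 with h3 | h3 <;> rw [h1] <;>
    rw [h1, h3] at ft <;> norm_num at ft <;> apply sub_eq_zero.1 <;>
    first
    | (rw [← ft]; module)
    | (rw [← neg_eq_zero, ← ft]; module)

theorem Ad (D : Dat X f) {c : A} (hc : IsC X f c) {x y : ℚ} (hx : X x = 1) (hy : X y = 1)
    (hx1 : x ≠ 1) (hy1 : y ≠ 1) (h : X (1 - x) = - X (1 - y)) : f y = f x + f (y / x) := by
  have x0 := D.ne0 (Or.inl hx)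
  have y0 := D.ne0 (Or.inl hy)
  have a1 : 1 - x ≠ 0 := sub_ne_zero.2 hx1.symm
  have a2 : 1 - y ≠ 0 := sub_ne_zero.2 hy1.symm
  have ft := D.ft' x0 y0 hx1 hy1
  have hs := D.sq a2
  rw [hc ((1 - x) / (1 - y)) (by rw [D.div, h]; linarith),
    hc (y * (1 - x) / (x * (1 - y))) (by rw [D.div, D.Xm, D.Xm, hx, hy, h]; linarith)] at ft
  have e3 : 1 - (1 - x) / (1 - y) = (x - y) / (1 - y) := by
    field_simp; ring
  have e4 : 1 - y * (1 - x) / (x * (1 - y)) = (x - y) / (x * (1 - y)) := by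
    field_simp; ring
  rw [e3, e4, hx] at ft
  simp only [D.div, D.Xm, hx] at ft
  apply sub_eq_zero.1
  rw [← neg_eq_zero, ← ft]
  module

theorem exD (D : Dat X f) {z0 : ℚ} (h0 : X z0 = -1) : ∃ d, X d = 1 ∧ X (1 - d) = -1 := by
  have z0' := D.ne0 (Or.inr h0)
  have z1 : 1 - z0 ≠ 0 := sub_ne_zero.2 (D.ne1 h0).symm
  rcases D.Xpm _ z1 with h | h
  · exact ⟨1 - z0, h, by rw [sub_sub_cancel, h0]⟩
  · refine ⟨1 - z0⁻¹, ?_, by rw [sub_sub_cancel, D.inv, h0]⟩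
    have : 1 - z0⁻¹ = -((1 - z0) / z0) := by field_simp; ring
    rw [this, D.neg, D.div, h, h0]; rfl

theorem dne1 (D : Dat X f) {x : ℚ} (h : X (1 - x) = 1 ∨ X (1 - x) = -1) : x ≠ 1 := by
  rintro rfl
  exact D.ne0 h (sub_self _)

/-- edges, before knowing the constant -/
theorem edge0 (D : Dat X f) {c : A} (hc : IsC X f c) {a b : ℚ} (ha : X a = 1)
    (ha' : X (1 - a) = 1) (hb : X b = 1) (h : X (a - b) = -1) :
    f b = f a + c - (f a + f (1 - a)) := by
  have b0 := D.ne0 (Or.inl hb)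
  have hR := D.R hc (y := 1 - a) (y' := b⁻¹) ha' (by rw [D.inv, hb])
    (by intro h; exact D.ne0 (Or.inl ha) (by linarith)) (by
      have : 1 - b⁻¹ * (1 - (1 - a)) = -((a - b) / b) := by field_simp; ring
      rw [this, D.neg, D.div, h, hb]; rfl)
  rw [D.fi _ b0, sub_sub_cancel, ha, one_smul] at hR
  rw [neg_eq_iff_eq_neg.1 hR]
  abel

theorem nine (D : Dat X f) : X (9 / 25) = 1 ∧ X (1 - 9 / 25) = 1 := by
  constructor
  · rw [show (9 / 25 : ℚ) = (3 / 5) * (3 / 5) by norm_num, D.Xm, D.sq (by norm_num)]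
  · rw [show (1 - 9 / 25 : ℚ) = (4 / 5) * (4 / 5) by norm_num, D.Xm, D.sq (by norm_num)]

theorem Cc (D : Dat X f) {c : A} (hc : IsC X f c) {z0 : ℚ} (h0 : X z0 = -1) :
    f (9 / 25) + f (1 - 9 / 25) = c := by
  obtain ⟨d, hd, hd'⟩ := D.exD h0
  obtain ⟨ha, ha'⟩ := D.nine
  set a : ℚ := 9 / 25 with hadef
  have d0 := D.ne0 (Or.inl hd)
  have a0 := D.ne0 (Or.inl ha)
  have a1 : a ≠ 1 := D.dne1 (Or.inl ha')
  have d1 : d ≠ 1 := D.dne1 (Or.inr hd')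
  have hb : X (a * d) = 1 := by rw [D.Xm, ha, hd]; rfl
  have hab : X (a - a * d) = -1 := by
    rw [show a - a * d = a * (1 - d) by ring, D.Xm, ha, hd']; rfl
  have hE := D.edge0 hc ha ha' hb hab
  have b1 : 1 - a * d ≠ 0 := by
    intro h
    have : d = a⁻¹ := by field_simp; linarith
    rw [this, show 1 - a⁻¹ = -((1 - a) / a) by field_simp; ring, D.neg, D.div, ha, ha'] at hd'
    omega
  rcases D.Xpm _ b1 with h | h
  · have hE2 := D.edge0 hc hb h ha (by rw [D.subc, hab])
    rw [D.C (D.ne0 (Or.inl hb)) a0 (D.dne1 (Or.inl h)) a1] at hE2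
    rw [hE] at hE2
    apply D.two
    apply sub_eq_zero.1
    have := sub_eq_zero.2 hE2
    rw [← this]
    abel
  · have h1 := D.Ad hc (x := a) (y := a * d) ha hb a1 (D.dne1 (Or.inr h)) (by rw [ha', h]; rfl)
    rw [mul_div_cancel_left₀ _ a0] at h1
    have h2 := D.C a0 d0 a1 d1
    rw [hc (1 - d) hd', sub_sub_cancel, hd, one_smul] at h2
    apply D.two
    rw [h2]
    rw [h2, h1] at hE
    apply sub_eq_zero.1
    have := sub_eq_zero.2 hE
    rw [← this]
    abel

theorem Cc' (D : Dat X f) {c : A} (hc : IsC X f c) {z0 : ℚ} (h0 : X z0 = -1) {x : ℚ}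
    (hx : x ≠ 0) (hx1 : x ≠ 1) : f x + f (1 - x) = c := by
  rw [D.C hx (y := 9 / 25) (by norm_num) hx1 (by norm_num), D.Cc hc h0]

theorem fD (D : Dat X f) {c : A} (hc : IsC X f c) {z0 : ℚ} (h0 : X z0 = -1) {d : ℚ}
    (hd : X d = 1) (hd' : X (1 - d) = -1) : f d = 0 := by
  have h2 := D.Cc' hc h0 (D.ne0 (Or.inl hd)) (D.dne1 (Or.inr hd'))
  rw [hc (1 - d) hd', sub_sub_cancel, hd, one_smul] at h2
  simpa using h2

theorem edge (D : Dat X f) {c : A} (hc : IsC X f c) {z0 : ℚ} (h0 : X z0 = -1) {a b : ℚ}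
    (ha : X a = 1) (hb : X b = 1) (h : X (a - b) = -1) : f a = f b := by
  by_cases a1 : a = 1
  · subst a1
    rw [D.f1, D.fD hc h0 hb h]
  by_cases b1 : b = 1
  · subst b1
    rw [D.f1, D.fD hc h0 ha (by rw [D.subc, h])]
  rcases D.Xpm (1 - a) (sub_ne_zero.2 (Ne.symm a1)) with h1 | h1
  · rw [D.edge0 hc ha h1 hb h, D.Cc' hc h0 (D.ne0 (Or.inl ha)) a1]
    abel
  rcases D.Xpm (1 - b) (sub_ne_zero.2 (Ne.symm b1)) with h3 | h3
  · rw [D.edge0 hc hb h3 ha (by rw [D.subc, h]), D.Cc' hc h0 (D.ne0 (Or.inl hb)) b1]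
    abel
  rw [D.fD hc h0 ha h1, D.fD hc h0 hb h3]

/-- stabilizer -/
def H (X : ℚ → ℤ) (f : ℚ → A) : Set ℚ := {h | X h = 1 ∧ ∀ s, X s = 1 → f (h * s) = f s}

theorem H1 (D : Dat X f) : (1 : ℚ) ∈ H X f := ⟨D.X1, fun s _ => by rw [one_mul]⟩

theorem Hmul (D : Dat X f) {a b : ℚ} (ha : a ∈ H X f) (hb : b ∈ H X f) : a * b ∈ H X f := by
  refine ⟨by rw [D.Xm, ha.1, hb.1]; rfl, fun s hs => ?_⟩
  rw [mul_assoc, ha.2 _ (by rw [D.Xm, hb.1, hs]; rfl), hb.2 s hs]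

theorem Hinv (D : Dat X f) {a : ℚ} (ha : a ∈ H X f) : a⁻¹ ∈ H X f := by
  have a0 := D.ne0 (Or.inl ha.1)
  refine ⟨by rw [D.inv, ha.1], fun s hs => ?_⟩
  rw [← ha.2 (a⁻¹ * s) (by rw [D.Xm, D.inv, ha.1, hs]; rfl), mul_inv_cancel_left₀ a0]

theorem Hf (D : Dat X f) {a : ℚ} (ha : a ∈ H X f) : f a = 0 := by
  have := ha.2 1 D.X1
  rwa [mul_one, D.f1] at this

theorem K (D : Dat X f) {c : A} (hc : IsC X f c) {z0 : ℚ} (h0 : X z0 = -1) {a b : ℚ}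
    (hab : X a = X b) (h : X (a - b) = - X a) (ha : a ≠ 0) (hb : b ≠ 0) : a / b ∈ H X f := by
  have hs := D.sq hb
  refine ⟨by rw [D.div, hab, hs], fun s hs' => ?_⟩
  apply D.edge hc h0 _ hs'
  · rw [show a / b * s - s = (a - b) / b * s by field_simp, D.Xm, D.div, h, hs', hab]
    linarith
  · rw [D.Xm, D.div, hab, hs, hs']; rfl

end Dat

structure Cm (X : ℚ → ℤ) (H : Set ℚ) : Prop where
  Xm : ∀ x y, X (x * y) = X x * X y
  Xpm : ∀ x, x ≠ 0 → X x = 1 ∨ X x = -1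
  neg : ∀ x, X (-x) = X x
  X1 : X 1 = 1
  HX : ∀ h ∈ H, X h = 1
  H0 : ∀ h ∈ H, h ≠ 0
  H1 : (1 : ℚ) ∈ H
  Hm : ∀ a ∈ H, ∀ b ∈ H, a * b ∈ H
  Hi : ∀ a ∈ H, a⁻¹ ∈ H
  K : ∀ a b, a ≠ 0 → b ≠ 0 → X a = X b → X (a - b) = - X a → a / b ∈ H

theorem prime_ind (P : ℚ → Prop) (h1 : P 1) (hm : ∀ a b, P a → P b → P (a * b)) (n : ℕ)
    (hn : n ≠ 0) (h : ∀ r : ℕ, r.Prime → r ∣ n → P r) : P n := by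
  induction n using induction_on_primes with
  | zero => exact absurd rfl hn
  | one => simpa using h1
  | prime_mul r m hr ih =>
    rw [Nat.cast_mul]
    exact hm _ _ (h r hr (dvd_mul_right _ _))
      (ih (by rintro rfl; simp at hn) (fun s hs hsm => h s hs (Dvd.dvd.mul_left hsm _)))

theorem ar1 {p q k : ℕ} (hq : q.Prime) (hpq : p < q) (hk : 1 ≤ k) (hkp : k + 1 < p) :
    ∃ b : ℕ, 1 ≤ b ∧ b < p ∧ |(b * q - k * p : ℤ)| < q ∧ |(b * q - (k + 1) * p : ℤ)| < q := by
  have hnd : ¬ q ∣ k * p := by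
    intro h
    rcases (Nat.Prime.dvd_mul hq).1 h with h | h
    · have := Nat.le_of_dvd (by omega) h; omega
    · have := Nat.le_of_dvd (by omega) h; omega
  have hlt : k * p / q < k := by
    apply Nat.div_lt_of_lt_mul
    nlinarith
  have h1 := Nat.div_add_mod (k * p) q
  have h2 := Nat.mod_lt (k * p) hq.pos
  have h3 : k * p % q ≠ 0 := fun h => hnd (Nat.dvd_of_mod_eq_zero h)
  refine ⟨k * p / q + 1, Nat.succ_le_succ (Nat.zero_le _), by
    generalize k * p / q = t at hlt ⊢
    omega, ?_, ?_⟩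
  · rw [abs_lt]
    have h1' : (q : ℤ) * (k * p / q : ℕ) + (k * p % q : ℕ) = k * p := by exact_mod_cast h1
    have h2' : ((k * p % q : ℕ) : ℤ) < q := by exact_mod_cast h2
    have h3' : (0 : ℤ) < ((k * p % q : ℕ) : ℤ) := by exact_mod_cast Nat.pos_of_ne_zero h3
    push_cast at h1' h2' h3' ⊢
    constructor <;> nlinarith
  · rw [abs_lt]
    have h1' : (q : ℤ) * (k * p / q : ℕ) + (k * p % q : ℕ) = k * p := by exact_mod_cast h1
    have h2' : ((k * p % q : ℕ) : ℤ) < q := by exact_mod_cast h2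
    have h3' : (0 : ℤ) < ((k * p % q : ℕ) : ℤ) := by exact_mod_cast Nat.pos_of_ne_zero h3
    have h4 : (p : ℤ) < q := by exact_mod_cast hpq
    push_cast at h1' h2' h3' ⊢
    constructor <;> nlinarith

theorem castcase (P : ℚ → Prop) (hneg : ∀ x, P x → P (-x)) (n : ℤ)
    (h : P ((n.natAbs : ℕ) : ℚ)) : P n := by
  obtain ⟨m, rfl | rfl⟩ := Int.eq_nat_or_neg n
  · simpa using h
  · rw [Int.natAbs_neg, Int.natAbs_natCast] at h
    push_cast
    exact hneg _ h

theorem nalt {n : ℤ} {q : ℕ} (h : |n| < q) : n.natAbs < q := by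
  rw [Int.abs_eq_natAbs] at h
  exact_mod_cast h

namespace Cm

variable {X : ℚ → ℤ} {H : Set ℚ}

theorem int1 (M : Cm X H) {p q : ℕ} 
    (small : ∀ r : ℕ, r.Prime → r < q → r ≠ p → X r = 1) (n : ℤ) (h : |n| < q)
    (hn : ¬ (p : ℤ) ∣ n) : X n = 1 := by
  have key : X (n.natAbs : ℕ) = 1 := by
    apply prime_ind (fun x => X x = 1) M.X1
    · intro a b ha hb
      simp only [M.Xm, ha, hb, mul_one]
    · intro h0
      apply hn
      rw [Int.natAbs_eq_zero.1 h0]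
      exact dvd_zero _
    · intro r hr hrn
      have hn0 : n.natAbs ≠ 0 := by
        intro h0
        apply hn
        rw [Int.natAbs_eq_zero.1 h0]
        exact dvd_zero _
      apply small r hr
      · have := Nat.le_of_dvd (Nat.pos_of_ne_zero hn0) hrn
        have := nalt h
        omega
      · rintro rfl
        exact hn (Int.natCast_dvd.2 hrn)
  exact castcase (fun x => X x = 1) (fun x hx => by simp only [M.neg, hx]) n key

/-- product cancellation -/
theorem tr (M : Cm X H) {a b : ℚ} (h : a / b ∈ H) (hb : b ∈ H) : a ∈ H := by
  have := M.Hm _ h _ hb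
  rwa [div_mul_cancel₀ _ (M.H0 _ hb)] at this

theorem st1 (M : Cm X H) {p q : ℕ} (hp : p.Prime) (hq : q.Prime) (hpq : p < q)
    (Xp : X p = -1) (Xq : X q = -1)
    (small : ∀ r : ℕ, r.Prime → r < q → r ≠ p → X r = 1) :
    (p * p : ℚ) ∈ H ∧ (-1 : ℚ) ∈ H ∧ (∀ n : ℕ, 0 < n → n < q → ¬ p ∣ n → (n : ℚ) ∈ H) ∧
      (q / p : ℚ) ∈ H := by
  have p0 : (p : ℚ) ≠ 0 := by exact_mod_cast hp.ne_zero
  have q0 : (q : ℚ) ≠ 0 := by exact_mod_cast hq.ne_zero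
  have I := M.int1 small
  have p2 := hp.two_le
  have hpq' : ¬ (p : ℤ) ∣ q := by
    intro h
    have := (Nat.prime_dvd_prime_iff_eq hp hq).1 (by exact_mod_cast h)
    omega
  have pp : Prime (p : ℤ) := Nat.prime_iff_prime_int.1 hp
  have nd : ∀ b : ℕ, 1 ≤ b → b < p → ¬ (p : ℤ) ∣ b := by
    intro b h1 h2 h
    have := Nat.le_of_dvd (by omega) (Int.natCast_dvd_natCast.1 h)
    omega
  have I' : ∀ b : ℕ, 1 ≤ b → b < p → X b = 1 := by
    intro b h1 h2
    have := I b (by rw [abs_lt]; constructor <;> omega) (nd b h1 h2)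
    exact_mod_cast this
  have step : ∀ b k : ℕ, 1 ≤ b → b < p → 1 ≤ k → k < p → |(b * q - k * p : ℤ)| < q →
      (b * q / (k * p) : ℚ) ∈ H := by
    intro b k hb hb' hk hk' h
    have h1 := I _ h (by
      intro h
      have h3 : (p : ℤ) ∣ b * q := (dvd_sub_left (dvd_mul_left _ _)).1 h
      rcases pp.dvd_or_dvd h3 with h | h
      · exact nd b hb hb' h
      · exact hpq' h)
    push_cast at h1
    have b0 : (b : ℚ) ≠ 0 := by exact_mod_cast (by omega)
    have k0 : (k : ℚ) ≠ 0 := by exact_mod_cast (by omega)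
    apply M.K _ _ (mul_ne_zero b0 q0) (mul_ne_zero k0 p0)
    · rw [M.Xm, M.Xm, I' b hb hb', I' k hk hk', Xp, Xq]
    · rw [h1, M.Xm, I' b hb hb', Xq]; rfl
  have A1 : ∀ k : ℕ, 1 ≤ k → k < p → (k : ℚ) ∈ H := by
    intro k hk
    induction k, hk using Nat.le_induction with
    | base => intro _; simpa using M.H1
    | succ k hk ih =>
      intro hkp
      obtain ⟨b, hb, hb', h1, h2⟩ := ar1 hq hpq hk hkp
      have s1 := step b k hb hb' hk (by omega) h1
      have s2 := step b (k + 1) hb hb' (by omega) hkp (by push_cast; exact h2)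
      have b0 : (b : ℚ) ≠ 0 := by exact_mod_cast (by omega)
      have k0 : (k : ℚ) ≠ 0 := by exact_mod_cast (by omega)
      have k1 : ((k + 1 : ℕ) : ℚ) ≠ 0 := Nat.cast_ne_zero.2 (Nat.succ_ne_zero k)
      have := M.Hm _ (M.Hm _ s1 _ (M.Hi _ s2)) _ (ih (by omega))
      convert this using 1
      field_simp
  have A2 : ∀ n : ℕ, 0 < n → n < q → ¬ p ∣ n → (n : ℚ) ∈ H := by
    intro n
    induction n using Nat.strong_induction_on with
    | _ n ih =>
      intro h0 hnq hpn
      by_cases hnp : n < p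
      · exact A1 n h0 hnp
      · have hne : n ≠ p := by rintro rfl; exact hpn dvd_rfl
        have hpn' : ¬ p ∣ n - p := by
          intro h
          apply hpn
          have h3 := Nat.dvd_add h (dvd_refl p)
          rwa [Nat.sub_add_cancel (by omega)] at h3
        have h1 := ih (n - p) (by omega) (by omega) (by omega) hpn'
        have hc : ((n - p : ℕ) : ℚ) = n - p := by
          rw [Nat.cast_sub (by omega)]
        have x1 := I n (by rw [abs_lt]; constructor <;> omega)
          (fun h => hpn (Int.natCast_dvd_natCast.1 h))
        push_cast at x1
        refine M.tr (M.K n ((n - p : ℕ) : ℚ) (by exact_mod_cast (by omega))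
          (M.H0 _ h1) ?_ ?_) h1
        · rw [M.HX _ h1, x1]
        · rw [hc, sub_sub_cancel, Xp, x1]
  have Am : (-1 : ℚ) ∈ H := by
    have h1 := A1 (p - 1) (by omega) (by omega)
    have hc : ((p - 1 : ℕ) : ℚ) = p - 1 := by
      rw [Nat.cast_sub (by omega)]; simp
    refine M.tr (M.K (-1) ((p - 1 : ℕ) : ℚ) (by norm_num) (M.H0 _ h1) ?_ ?_) h1
    · rw [M.HX _ h1, M.neg, M.X1]
    · rw [hc, show (-1 : ℚ) - (p - 1) = -p by ring, M.neg, M.neg, Xp, M.X1]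
  refine ⟨?_, Am, A2, ?_⟩
  · obtain ⟨b, n, hb, hb', hn0, hn, e⟩ : ∃ (b : ℕ) (n : ℤ), 1 ≤ b ∧ b < p ∧ n ≠ 0 ∧ |n| < q ∧
        (p * p : ℤ) = n + b * q := by
      by_cases h : p * p < q
      · refine ⟨1, p * p - q, le_refl _, by omega, ?_, ?_, by push_cast; ring⟩
        · intro h'
          have : (p * p : ℤ) < q := by exact_mod_cast h
          omega
        · rw [abs_lt]
          have : (p * p : ℤ) < q := by exact_mod_cast h
          have h3 : (0 : ℤ) < p * p := by positivity
          constructor <;> omega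
      · have h1 := Nat.div_add_mod (p * p) q
        have h2 := Nat.mod_lt (p * p) hq.pos
        have h3 : p * p % q ≠ 0 := by
          intro h
          rcases (Nat.Prime.dvd_mul hq).1 (Nat.dvd_of_mod_eq_zero h) with h | h <;>
          · have := Nat.le_of_dvd (by omega) h; omega
        refine ⟨p * p / q, ((p * p % q : ℕ) : ℤ), Nat.div_pos (by omega) hq.pos, ?_, ?_, ?_, ?_⟩
        · apply Nat.div_lt_of_lt_mul
          nlinarith
        · exact_mod_cast h3
        · rw [abs_lt]; constructor <;> omega
        · rw [mul_comm ((p * p / q : ℕ) : ℤ), add_comm]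
          exact_mod_cast h1.symm
    have hpn : ¬ (p : ℤ) ∣ n := by
      intro h
      have : (p : ℤ) ∣ b * q := by
        have h3 : (b * q : ℤ) = p * p - n := by rw [e]; ring
        rw [h3]
        exact dvd_sub (dvd_mul_left _ _) h
      rcases pp.dvd_or_dvd this with h | h
      · exact nd b hb hb' h
      · exact hpq' h
    have hnH : (n : ℚ) ∈ H := by
      have h1 := A2 n.natAbs (by omega) (nalt hn) (fun h => hpn (Int.natCast_dvd.2 h))
      exact castcase (· ∈ H) (fun x hx => by
        have := M.Hm _ Am _ hx
        rwa [neg_one_mul] at this) n h1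
    have eq : (p * p : ℚ) = n + b * q := by exact_mod_cast e
    refine M.tr (M.K (p * p) n (mul_ne_zero p0 p0) (M.H0 _ hnH) ?_ ?_) hnH
    · rw [M.HX _ hnH, M.Xm, Xp]; rfl
    · rw [M.Xm (p : ℚ), Xp, eq, add_sub_cancel_left, M.Xm, Xq, I' b hb hb']; rfl
  · have h := I (q - p) (by rw [abs_lt]; constructor <;> omega) (by
      intro h
      exact hpq' ((dvd_sub_left (dvd_refl _)).1 h))
    push_cast at h
    exact M.K _ _ q0 p0 (by rw [Xp, Xq]) (by rw [h, Xq]; rfl)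

/-- the subgroup generated by H and p -/
def G (H : Set ℚ) (p : ℚ) (x : ℚ) : Prop := x ∈ H ∨ x * p ∈ H

section
variable {p : ℚ}

theorem Gm (M : Cm X H) (hpp : p * p ∈ H) {a b : ℚ} (ha : G H p a) (hb : G H p b) :
    G H p (a * b) := by
  have p0 : p ≠ 0 := fun h => M.H0 _ hpp (by rw [h, mul_zero])
  rcases ha with ha | ha <;> rcases hb with hb | hb
  · exact Or.inl (M.Hm _ ha _ hb)
  · right
    convert M.Hm _ ha _ hb using 1; ring
  · right
    convert M.Hm _ ha _ hb using 1; ring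
  · left
    convert M.Hm _ (M.Hm _ ha _ hb) _ (M.Hi _ hpp) using 1
    field_simp

theorem Gi (M : Cm X H) (hpp : p * p ∈ H) {a : ℚ} (ha : G H p a) : G H p a⁻¹ := by
  have p0 : p ≠ 0 := fun h => M.H0 _ hpp (by rw [h, mul_zero])
  rcases ha with ha | ha
  · exact Or.inl (M.Hi _ ha)
  · right
    have a0 : a ≠ 0 := fun h => M.H0 _ ha (by rw [h, zero_mul])
    convert M.Hm _ (M.Hi _ ha) _ hpp using 1
    field_simp

theorem Gd (M : Cm X H) (hpp : p * p ∈ H) {a b : ℚ} (ha : G H p a) (hb : G H p b) :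
    G H p (a / b) := by
  rw [div_eq_mul_inv]
  exact M.Gm hpp ha (M.Gi hpp hb)

theorem G0 (M : Cm X H) {a : ℚ} (ha : G H p a) : a ≠ 0 := by
  rcases ha with ha | ha
  · exact M.H0 _ ha
  · intro h; exact M.H0 _ ha (by rw [h, zero_mul])

theorem GH (M : Cm X H) (Xp : X p = -1) {a : ℚ} (ha : G H p a) (h : X a = 1) : a ∈ H := by
  rcases ha with ha | ha
  · exact ha
  · have := M.HX _ ha
    rw [M.Xm, Xp, h] at this
    omega

/-- relation transported -/
theorem Gt (M : Cm X H) (hpp : p * p ∈ H) {a b : ℚ} (ha : a ≠ 0) (hb : G H p b)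
    (h1 : X a = X b) (h2 : X (a - b) = - X a) : G H p a := by
  have := M.Gm hpp (Or.inl (M.K a b ha (M.G0 hb) h1 h2)) hb
  rwa [div_mul_cancel₀ _ (M.G0 hb)] at this

theorem Gint (M : Cm X H) (hpp : p * p ∈ H) (hm1 : (-1 : ℚ) ∈ H) {n : ℤ} (hn : n ≠ 0)
    (h : ∀ r : ℕ, r.Prime → r ∣ n.natAbs → G H p r) : G H p n := by
  have h1 := prime_ind (G H p) (Or.inl M.H1) (fun a b => M.Gm hpp) n.natAbs (by omega) h
  exact castcase (G H p) (fun x hx => by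
    have := M.Gm hpp (Or.inl hm1) hx
    rwa [neg_one_mul] at this) n h1

end

end Cm

namespace Cm

variable {X : ℚ → ℤ} {H : Set ℚ}

theorem T (M : Cm X H) {p : ℚ} (hpp : p * p ∈ H) (hm1 : (-1 : ℚ) ∈ H) {l : ℚ} (l0 : l ≠ 0)
    (hl : ¬ G H p l) {a b k : ℚ} (ha : G H p a) (hb : G H p b) (hk : G H p k)
    (e : a = b + k * l) : X a = X b := by
  by_contra hne
  have kl0 : k * l ≠ 0 := mul_ne_zero (M.G0 hk) l0
  have fin : G H p (k * l) → False := by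
    intro h
    have := M.Gd hpp h hk
    rw [mul_div_cancel_left₀ _ (M.G0 hk)] at this
    exact hl this
  have xa := M.Xpm _ (M.G0 ha)
  have xb := M.Xpm _ (M.G0 hb)
  have xk := M.Xpm _ kl0
  by_cases h : X (k * l) = X a
  · apply fin
    refine M.Gt hpp kl0 ha h ?_
    rw [show k * l - a = -b by rw [e]; ring, M.neg]
    omega
  · apply fin
    have hb' : G H p (-b) := by
      have := M.Gm hpp (Or.inl hm1) hb
      rwa [neg_one_mul] at this
    refine M.Gt hpp kl0 hb' (by rw [M.neg]; omega) ?_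
    rw [show k * l - -b = a by rw [e]; ring]
    omega

theorem st2 (M : Cm X H) {p l : ℕ} (hp : p.Prime) (hl : l.Prime) (hpl : p < l)
    (Xp : X p = -1) (hpp : (p * p : ℚ) ∈ H) (hm1 : (-1 : ℚ) ∈ H)
    (hlG : ¬ G H p l) (hs : ∀ r : ℕ, r.Prime → r < l → G H p r) (n : ℤ) (hn : ¬ (l : ℤ) ∣ n) :
    G H p n ∧ X n = X ((n % l : ℤ) : ℚ) := by
  have l0 : (l : ℚ) ≠ 0 := by exact_mod_cast hl.ne_zero
  have lp : (0 : ℤ) < l := by exact_mod_cast hl.pos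
  have pl : Prime (l : ℤ) := Nat.prime_iff_prime_int.1 hl
  have sm : ∀ n : ℤ, n ≠ 0 → |n| < l → G H p n := by
    intro n h0 h
    apply M.Gint hpp hm1 h0
    intro r hr hrn
    apply hs r hr
    have := Nat.le_of_dvd (by omega) hrn
    have := nalt h
    omega
  have md : ∀ a : ℤ, ¬ (l : ℤ) ∣ a → 0 < a % l ∧ a % l < l := by
    intro a ha
    have h1 := Int.emod_nonneg a lp.ne'
    have h2 := Int.emod_lt_of_pos a lp
    have h3 : a % l ≠ 0 := fun h => ha (Int.dvd_of_emod_eq_zero h)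
    omega
  have sm' : ∀ n : ℤ, 0 < n → n < l → G H p n := by
    intro n h0 h
    exact sm n h0.ne' (by rw [abs_of_pos h0]; exact h)
  obtain ⟨Y, hY⟩ : ∃ Y : ℤ → ℤ, Y = fun n : ℤ => X ((n % l : ℤ) : ℚ) := ⟨_, rfl⟩
  have Ym : ∀ a b : ℤ, ¬ (l : ℤ) ∣ a → ¬ (l : ℤ) ∣ b → Y (a * b) = Y a * Y b := by
    intro a b ha hb
    have hab : ¬ (l : ℤ) ∣ a * b := fun h => by
      rcases pl.dvd_or_dvd h with h | h
      · exact ha h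
      · exact hb h
    simp only [hY]
    obtain ⟨a1, a2⟩ := md a ha
    obtain ⟨b1, b2⟩ := md b hb
    obtain ⟨c1, c2⟩ := md _ hab
    rw [Int.mul_emod] at c1 c2 ⊢
    generalize a % l = α at *
    generalize b % l = β at *
    have h1 := Int.emod_add_mul_ediv (α * β) l
    have k0 : 0 ≤ (α * β) / l := Int.ediv_nonneg (by positivity) lp.le
    have k1 : (α * β) / l < l := by
      apply Int.ediv_lt_of_lt_mul lp
      nlinarith
    generalize α * β / l = k at *
    generalize α * β % l = ρ at *
    rw [← M.Xm]
    have e : (α * β : ℚ) = ρ + k * l := by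
      rw [mul_comm (k : ℚ)]
      exact_mod_cast h1.symm
    rcases k0.eq_or_lt with h | h
    · rw [e, ← h]; simp
    · exact (M.T hpp hm1 l0 hlG (M.Gm hpp (sm' α a1 a2) (sm' β b1 b2)) (sm' ρ c1 c2)
        (sm' k h k1) e).symm
  have Yn : ∀ a : ℤ, ¬ (l : ℤ) ∣ a → Y (-a) = Y a := by
    intro a ha
    simp only [hY]
    obtain ⟨a1, a2⟩ := md a ha
    have h : (-a) % l = l - a % l := by
      have h1 := Int.emod_add_mul_ediv a l
      have : -a = (l - a % l) + l * (-(a / l) - 1) := by linarith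
      rw [this, Int.add_mul_emod_self_left]
      exact Int.emod_eq_of_lt (by omega) (by omega)
    rw [h]
    generalize a % l = α at *
    have := M.T hpp hm1 l0 hlG (a := (α : ℚ)) (b := ((α - l : ℤ) : ℚ)) (k := 1) (sm' α a1 a2)
      (sm _ (by omega) (by rw [abs_lt]; constructor <;> omega)) (Or.inl M.H1)
      (by push_cast; ring)
    rw [this, ← M.neg]
    congr 1
    push_cast
    ring
  let P : ℚ → Prop := fun x => ∃ m : ℤ, x = m ∧ ¬ (l : ℤ) ∣ m ∧ G H p x ∧ X x = Y m
  have P1 : P 1 := by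
    refine ⟨1, by simp, ?_, Or.inl M.H1, ?_⟩
    · intro h
      have := Int.le_of_dvd one_pos h
      have := hl.two_le
      omega
    · simp only [hY]
      rw [Int.emod_eq_of_lt (by omega) (by have := hl.two_le; omega)]
      simp
  have Pm : ∀ a b, P a → P b → P (a * b) := by
    rintro a b ⟨m, rfl, m1, m2, m3⟩ ⟨m', rfl, m1', m2', m3'⟩
    refine ⟨m * m', by push_cast; rfl, ?_, M.Gm hpp m2 m2', ?_⟩
    · intro h
      rcases pl.dvd_or_dvd h with h | h
      · exact m1 h
      · exact m1' h
    · rw [M.Xm, m3, m3', Ym _ _ m1 m1']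
  have Pn : ∀ a, P a → P (-a) := by
    rintro a ⟨m, rfl, m1, m2, m3⟩
    refine ⟨-m, by push_cast; rfl, ?_, ?_, ?_⟩
    · rwa [dvd_neg]
    · have := M.Gm hpp (Or.inl hm1) m2
      rwa [neg_one_mul] at this
    · rw [M.neg, m3, Yn _ m1]
  have Pint : ∀ n : ℤ, n ≠ 0 → (∀ r : ℕ, r.Prime → r ∣ n.natAbs → P r) → G H p n ∧ X n = Y n := by
    intro n h0 h
    obtain ⟨m, m0, m1, m2, m3⟩ :=
      castcase P Pn n (prime_ind P P1 Pm n.natAbs (by omega) h)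
    have : n = m := by exact_mod_cast m0
    subst this
    exact ⟨m2, m3⟩
  have main : ∀ r : ℕ, r.Prime → r ≠ l → P r := by
    intro r
    induction r using Nat.strong_induction_on with
    | _ r ih =>
      intro hr hrl
      have hndr : ¬ (l : ℤ) ∣ r := by
        intro h
        exact hrl ((Nat.prime_dvd_prime_iff_eq hl hr).1 (by exact_mod_cast h)).symm
      rcases lt_or_gt_of_ne hrl with hlt | hgt
      · refine ⟨r, by simp, hndr, hs r hr hlt, ?_⟩
        simp only [hY]
        rw [Int.emod_eq_of_lt (by omega) (by omega)]
        simp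
      by_contra hP
      have small : ∀ n : ℤ, ¬ (l : ℤ) ∣ n → |n| < r → G H p n ∧ X n = Y n := by
        intro n hn h
        have n0 : n ≠ 0 := by rintro rfl; exact hn (dvd_zero _)
        apply Pint n n0
        intro s hs' hsn
        have h1 := Nat.le_of_dvd (by omega) hsn
        have h2 := nalt h
        apply ih s (by omega) hs'
        rintro rfl
        exact hn (Int.natCast_dvd.2 hsn)
      have nd : ∀ b : ℕ, 1 ≤ b → b < l → ¬ (l : ℤ) ∣ b := by
        intro b h1 h2 h
        have := Nat.le_of_dvd (by omega) (Int.natCast_dvd_natCast.1 h)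
        omega
      have r0 : (r : ℚ) ≠ 0 := by exact_mod_cast hr.ne_zero
      have step : ∀ b k : ℕ, 1 ≤ b → b < l → 1 ≤ k → k < l → |(b * r - k * l : ℤ)| < r →
          X k = X b * X r * X l := by
        intro b k hb hb' hk hk' h
        have hnbr : ¬ (l : ℤ) ∣ b * r := by
          intro h3
          rcases pl.dvd_or_dvd h3 with h | h
          · exact nd b hb hb' h
          · exact hndr h
        have hnd : ¬ (l : ℤ) ∣ (b * r - k * l : ℤ) := by
          intro h
          exact hnbr ((dvd_sub_left (dvd_mul_left _ _)).1 h)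
        obtain ⟨mG, mX⟩ := small _ hnd h
        obtain ⟨bG, bX⟩ := small b (nd b hb hb') (by rw [abs_lt]; constructor <;> omega)
        obtain ⟨kG, kX⟩ := small k (nd k hk hk') (by rw [abs_lt]; constructor <;> omega)
        have mX' : X ((b * r - k * l : ℤ) : ℚ) = X b * Y r := by
          rw [mX]
          have : Y (b * r - k * l : ℤ) = Y (b * r) := by
            simp only [hY]
            rw [sub_eq_add_neg, ← neg_mul, Int.add_mul_emod_self_right]
          rw [this, Ym _ _ (nd b hb hb') hndr, ← bX]
          simp
        generalize hm : (b * r - k * l : ℤ) = m at *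
        have e : (b * r - k * l : ℚ) = m := by exact_mod_cast hm
        simp only [Int.cast_natCast] at bG kG
        have xb := M.Xpm _ (M.G0 bG)
        have xk := M.Xpm _ (M.G0 kG)
        have xl := M.Xpm _ l0
        have xr := M.Xpm _ r0
        have br0 : (b * r : ℚ) ≠ 0 := mul_ne_zero (M.G0 bG) r0
        have kl0 : (k * l : ℚ) ≠ 0 := mul_ne_zero (M.G0 kG) l0
        by_contra hne
        have hne' : X (k * l) = - X (b * r) := by
          rw [M.Xm, M.Xm]
          rcases xb with xb | xb <;> rcases xk with xk | xk <;> rcases xl with xl | xl <;>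
            rcases xr with xr | xr <;> rw [xb, xk, xl, xr] at hne ⊢ <;> revert hne <;> decide
        have xm := M.Xpm _ (M.G0 mG)
        have xbr := M.Xpm _ br0
        by_cases hc : X m = X (b * r)
        · apply hP
          have hg : G H p (b * r) := by
            refine M.Gt hpp br0 mG hc.symm ?_
            rw [← e, sub_sub_cancel, hne']
          have hg' := M.Gd hpp hg bG
          rw [mul_div_cancel_left₀ _ (M.G0 bG)] at hg'
          refine ⟨r, by simp, hndr, hg', ?_⟩
          rw [mX', M.Xm] at hc
          rcases xb with xb | xb <;> rw [xb] at hc <;> omega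
        · apply hlG
          have hg : G H p (k * l) := by
            refine M.Gt hpp kl0 (b := -m) ?_ (by rw [M.neg]; omega) ?_
            · have := M.Gm hpp (Or.inl hm1) mG
              rwa [neg_one_mul] at this
            · rw [← e, show (k * l : ℚ) - -(b * r - k * l) = b * r by ring]; omega
          have hg' := M.Gd hpp hg kG
          rwa [mul_div_cancel_left₀ _ (M.G0 kG)] at hg'
      have all1 : ∀ k : ℕ, 1 ≤ k → k < l → X k = 1 := by
        intro k hk
        induction k, hk using Nat.le_induction with
        | base => intro _; simpa using M.X1
        | succ k hk ihk =>
          intro hkl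
          obtain ⟨b, hb, hb', h1, h2⟩ := ar1 hr hgt hk hkl
          have s1 := step b k hb hb' hk (by omega) h1
          have s2 := step b (k + 1) hb hb' (by omega) hkl (by push_cast; exact h2)
          rw [s2, ← s1]
          exact ihk (by omega)
      have := all1 p hp.one_lt.le hpl
      omega
  have n0 : n ≠ 0 := by rintro rfl; exact hn (dvd_zero _)
  have := Pint n n0 (fun r hr hrn => main r hr (by
    rintro rfl
    exact hn (Int.natCast_dvd.2 hrn)))
  rw [hY] at this
  exact this

end Cm

namespace Dat

variable {A : Type} [AddCommGroup A] {X : ℚ → ℤ} {f : ℚ → A}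

theorem cm (D : Dat X f) {z0 : ℚ} (h0 : X z0 = -1) : Cm X (H X f) where
  Xm := D.Xm
  Xpm := D.Xpm
  neg := D.neg
  X1 := D.X1
  HX := fun _ h => h.1
  H0 := fun _ h => D.ne0 (Or.inl h.1)
  H1 := D.H1
  Hm := fun _ ha _ hb => D.Hmul ha hb
  Hi := fun _ ha => D.Hinv ha
  K := fun a b ha hb h1 h2 => by
    obtain ⟨c, hc⟩ := D.exC h0
    exact D.K hc h0 h1 h2 ha hb

theorem final (D : Dat X f) {p' q' : ℕ} (hp' : p'.Prime) (hq' : q'.Prime) (hne : p' ≠ q')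
    (Xp' : X p' = -1) (Xq' : X q' = -1) (x : ℚ) (hx : x ≠ 0) : f x = 0 := by
  classical
  obtain ⟨p, q, hp, hq, hpq, Xp, Xq, small⟩ : ∃ p q : ℕ, p.Prime ∧ q.Prime ∧ p < q ∧
      X p = -1 ∧ X q = -1 ∧ ∀ r : ℕ, r.Prime → r < q → r ≠ p → X r = 1 := by
    have e1 : ∃ p : ℕ, p.Prime ∧ X p = -1 := ⟨p', hp', Xp'⟩
    have e2 : ∃ q : ℕ, q.Prime ∧ X q = -1 ∧ q ≠ Nat.find e1 := by
      by_cases h : p' = Nat.find e1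
      · exact ⟨q', hq', Xq', fun h' => hne (h.trans h'.symm)⟩
      · exact ⟨p', hp', Xp', h⟩
    obtain ⟨h1, h2⟩ := Nat.find_spec e1
    obtain ⟨h3, h4, h5⟩ := Nat.find_spec e2
    refine ⟨Nat.find e1, Nat.find e2, h1, h3, ?_, h2, h4, ?_⟩
    · exact lt_of_le_of_ne (Nat.find_min' e1 ⟨h3, h4⟩) (Ne.symm h5)
    · intro r hr hrq hrp
      rcases D.Xpm r (by exact_mod_cast hr.ne_zero) with h | h
      · exact h
      · exact absurd ⟨hr, h, hrp⟩ (Nat.find_min e2 hrq)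
  obtain ⟨c, hc⟩ := D.exC Xp
  have M := D.cm Xp
  obtain ⟨hpp, hm1, hsm, hqp⟩ := M.st1 hp hq hpq Xp Xq small
  have p0 : (p : ℚ) ≠ 0 := by exact_mod_cast hp.ne_zero
  have suff : c = 0 → (∀ x, X x = 1 → f x = 0) → f x = 0 := by
    intro h0 h1
    rcases D.Xpm x hx with h | h
    · exact h1 x h
    · rw [hc x h, h0, smul_zero]
  have GH : ∀ a, Cm.G (H X f) p a → X a = 1 → f a = 0 := fun a h1 h2 => D.Hf (M.GH Xp h1 h2)
  have c345 : Cm.G (H X f) p 3 → Cm.G (H X f) p 2 → Cm.G (H X f) p 5 → c = 0 := by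
    intro h3 h2 h5
    obtain ⟨n1, n2⟩ := D.nine
    have h9 : Cm.G (H X f) p (9 / 25) := by
      rw [show (9 / 25 : ℚ) = 3 * 3 / (5 * 5) by norm_num]
      exact M.Gd hpp (M.Gm hpp h3 h3) (M.Gm hpp h5 h5)
    have h16 : Cm.G (H X f) p (1 - 9 / 25) := by
      rw [show (1 - 9 / 25 : ℚ) = (2 * 2) * (2 * 2) / (5 * 5) by norm_num]
      exact M.Gd hpp (M.Gm hpp (M.Gm hpp h2 h2) (M.Gm hpp h2 h2)) (M.Gm hpp h5 h5)
    rw [← D.Cc hc Xp, GH _ h9 n1, GH _ h16 n2, add_zero]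
  by_cases hall : ∀ r : ℕ, r.Prime → Cm.G (H X f) p r
  · apply suff
    · exact c345 (by exact_mod_cast hall 3 Nat.prime_three)
        (by exact_mod_cast hall 2 Nat.prime_two) (by exact_mod_cast hall 5 Nat.prime_five)
    · intro x hx
      have x0 := D.ne0 (Or.inl hx)
      apply GH x _ hx
      rw [← Rat.num_div_den x]
      apply M.Gd hpp
      · exact M.Gint hpp hm1 (Rat.num_ne_zero.2 x0) (fun r hr _ => hall r hr)
      · have := M.Gint hpp hm1 (n := (x.den : ℤ)) (by exact_mod_cast x.den_nz)
          (fun r hr _ => hall r hr)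
        exact_mod_cast this
  · have hall' : ∃ l : ℕ, l.Prime ∧ ¬ Cm.G (H X f) p l := by
      by_contra h
      push Not at h
      exact hall h
    obtain ⟨l, hl, hlG, lmin⟩ : ∃ l : ℕ, l.Prime ∧ ¬ Cm.G (H X f) p l ∧
        ∀ r : ℕ, r.Prime → r < l → Cm.G (H X f) p r := by
      classical
      obtain ⟨h1, h2⟩ := Nat.find_spec hall'
      refine ⟨_, h1, h2, fun r hr hrl => ?_⟩
      by_contra h
      exact Nat.find_min hall' hrl ⟨hr, h⟩
    have hql : q < l := by
      by_contra hle
      apply hlG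
      by_cases h1 : l = p
      · right
        rw [h1]; exact hpp
      by_cases h2 : l = q
      · right
        rw [h2]
        convert M.Hm _ hqp _ hpp using 1
        field_simp
      · left
        apply hsm l hl.pos (by omega)
        intro h
        exact h1 ((Nat.prime_dvd_prime_iff_eq hp hl).1 h).symm
    have S := M.st2 hp hl (hpq.trans hql) Xp hpp hm1 hlG lmin
    have pl : Prime (l : ℤ) := Nat.prime_iff_prime_int.1 hl
    have hq3 : 3 ≤ q := by have := hp.two_le; omega
    have c0 : c = 0 := by
      by_cases h5 : l = 5
      · have hp2 : p = 2 := by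
          have := hp.two_le
          have hq4 : q ≠ 4 := by rintro rfl; revert hq; decide
          omega
        have hq3' : q = 3 := by
          have hq4 : q ≠ 4 := by rintro rfl; revert hq; decide
          omega
        subst h5 hp2 hq3'
        have x13 := (S 13 (by decide)).2
        rw [show (13 % (5 : ℕ) : ℤ) = 3 by rfl] at x13
        push_cast at x13 Xq
        rw [Xq] at x13
        have x4 : X 4 = 1 := by
          rw [show (4 : ℚ) = 2 * 2 by norm_num, D.Xm, D.sq (by norm_num)]
        have f4 : f 4 = 0 := by
          apply GH 4 _ x4
          have := (S 4 (by decide)).1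
          exact_mod_cast this
        have := D.R hc x4 x4 (by norm_num) (by
          rw [show (1 - 4 * (1 - 4) : ℚ) = 13 by norm_num]; exact x13)
        rw [f4] at this
        simpa using this
      · have nd : ∀ k : ℕ, k.Prime → k ≠ l → Cm.G (H X f) p k := by
          intro k hk hkl
          have := (S k (by
            intro h
            exact hkl ((Nat.prime_dvd_prime_iff_eq hl hk).1 (by exact_mod_cast h)).symm)).1
          exact_mod_cast this
        exact c345 (by exact_mod_cast nd 3 Nat.prime_three (by omega))
          (by exact_mod_cast nd 2 Nat.prime_two (by omega))
          (by exact_mod_cast nd 5 Nat.prime_five (by omega))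
    apply suff c0
    have pos : ∀ x, X x = 1 → ¬ (l : ℤ) ∣ x.den → f x = 0 := by
      intro x hx hd
      have x0 := D.ne0 (Or.inl hx)
      have dG := (S x.den hd).1
      have d0 : (x.den : ℚ) ≠ 0 := by exact_mod_cast x.den_nz
      push_cast at dG
      by_cases hn : (l : ℤ) ∣ x.num
      · have hnd : ¬ (l : ℤ) ∣ (x.den - x.num) := fun h => hd ((dvd_sub_left hn).1 h)
        obtain ⟨g1, g2⟩ := S _ hnd
        have e : 1 - x = ((x.den - x.num : ℤ) : ℚ) / x.den := by
          nth_rewrite 1 [← Rat.num_div_den x]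
          push_cast
          field_simp
        have hX : X (1 - x) = 1 := by
          rw [e, D.div, g2]
          have h2 := (S x.den hd).2
          have : ((x.den : ℤ) - x.num) % l = (x.den : ℤ) % l := by
            obtain ⟨t, ht⟩ := hn
            rw [ht, sub_eq_add_neg, ← mul_neg, Int.add_mul_emod_self_left]
          rw [this, ← h2]
          push_cast
          exact D.sq d0
        have x1 : x ≠ 1 := D.dne1 (Or.inl hX)
        have h1 := D.Cc' hc Xp x0 x1
        rw [GH (1 - x) (by rw [e]; exact M.Gd hpp g1 dG) hX, add_zero, c0] at h1
        exact h1
      · apply GH x _ hx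
        rw [← Rat.num_div_den x]
        exact M.Gd hpp (S _ hn).1 dG
    intro x hx
    have x0 := D.ne0 (Or.inl hx)
    by_cases hd : (l : ℤ) ∣ x.den
    · have h := pos x⁻¹ (by rw [D.inv, hx]) (by
        rw [Rat.den_inv_of_ne_zero x0]
        intro h
        have h3 : l ∣ Nat.gcd x.num.natAbs x.den :=
          Nat.dvd_gcd (Int.natCast_dvd_natCast.1 h) (Int.natCast_dvd_natCast.1 hd)
        rw [x.reduced] at h3
        exact hl.one_lt.ne' (Nat.dvd_one.1 h3))
      rw [D.fi x x0] at h
      exact neg_eq_zero.1 h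
    · exact pos x hx hd

end Dat

section bridge

variable (χ : SqCl ℚ →* ℤˣ)

/-- character as an integer valued function -/
noncomputable def XX (x : ℚ) : ℤ := if h : x ≠ 0 then (χ (sqc ℚ (U ℚ x h)) : ℤ) else 0

theorem XX_unit (x : ℚˣ) : XX χ x = (χ (sqc ℚ x) : ℤ) := by
  unfold XX
  rw [dif_pos x.ne_zero]
  congr 3
  ext
  rfl

theorem XX_U (x : ℚ) (h : x ≠ 0) : (χ (sqc ℚ (U ℚ x h)) : ℤ) = XX χ x := by
  unfold XX
  rw [dif_pos h]

/-- first map -/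
noncomputable def mkA : FreeRP ℚ →ₗ[RF ℚ] RP' ℚ :=
  Submodule.mkQ (Submodule.span (RF ℚ)
    ({gen ℚ 1} ∪ ftRels ℚ ∪ minusRels ℚ ∪ invRels ℚ))

/-- second map -/
noncomputable def mkB : RP' ℚ →ₗ[RF ℚ] Loc2 ℚ (RP' ℚ) :=
  LocalizedModule.mkLinearMap (Submonoid.powers (2 : RF ℚ)) (RP' ℚ)

/-- third map -/
noncomputable def mkC : Loc2 ℚ (RP' ℚ) →ₗ[RF ℚ] ChiQuot ℚ χ (Loc2 ℚ (RP' ℚ)) :=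
  Submodule.mkQ (chiSub ℚ χ (Loc2 ℚ (RP' ℚ)))

/-- the composite map from the free module -/
noncomputable def phi : FreeRP ℚ →ₗ[RF ℚ] ChiQuot ℚ χ (Loc2 ℚ (RP' ℚ)) :=
  (mkC χ).comp (mkB.comp mkA)

theorem phi_rel {w : FreeRP ℚ}
    (h : w ∈ ({gen ℚ 1} ∪ ftRels ℚ ∪ minusRels ℚ ∪ invRels ℚ : Set (FreeRP ℚ))) :
    phi χ w = 0 := by
  have h0 : mkA w = 0 :=
    (Submodule.Quotient.mk_eq_zero _).2 (Submodule.subset_span h)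
  change mkC χ (mkB (mkA w)) = 0
  rw [h0, map_zero, map_zero]

theorem cls_smul (a : ℚˣ) (v : ChiQuot ℚ χ (Loc2 ℚ (RP' ℚ))) :
    cls ℚ a • v = XX χ a • v := by
  obtain ⟨m, rfl⟩ := Submodule.Quotient.mk_surjective _ v
  rw [XX_unit, ← sub_eq_zero]
  have h : cls ℚ a • m - ((χ (sqc ℚ a) : ℤ)) • m ∈ chiSub ℚ χ (Loc2 ℚ (RP' ℚ)) :=
    Submodule.subset_span ⟨a, m, rfl⟩
  exact (Submodule.Quotient.mk_eq_zero _).2 h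

theorem twoinj (v : ChiQuot ℚ χ (Loc2 ℚ (RP' ℚ))) (h : (2 : RF ℚ) • v = 0) : v = 0 := by
  obtain ⟨m, rfl⟩ := Submodule.Quotient.mk_surjective _ v
  have h' : (2 : RF ℚ) • m ∈ chiSub ℚ χ (Loc2 ℚ (RP' ℚ)) :=
    (Submodule.Quotient.mk_eq_zero _).1 h
  apply (Submodule.Quotient.mk_eq_zero _).2
  have hu : IsUnit (algebraMap (RF ℚ) (Module.End (RF ℚ) (Loc2 ℚ (RP' ℚ))) 2) :=
    IsLocalizedModule.map_units (S := Submonoid.powers (2 : RF ℚ))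
      (LocalizedModule.mkLinearMap (Submonoid.powers (2 : RF ℚ)) (RP' ℚ))
      ⟨2, Submonoid.mem_powers _⟩
  obtain ⟨u, hu⟩ := hu
  set g : Module.End (RF ℚ) (Loc2 ℚ (RP' ℚ)) := (u⁻¹ : _ˣ).val with hg
  have hg2 : ∀ x, g ((2 : RF ℚ) • x) = x := by
    intro x
    have h1 : g * u.val = 1 := by rw [hg]; simp
    have h2 := LinearMap.congr_fun h1 x
    rw [hu] at h2
    simpa [Module.End.mul_apply] using h2
  have hst : (chiSub ℚ χ (Loc2 ℚ (RP' ℚ))).map g ≤ chiSub ℚ χ (Loc2 ℚ (RP' ℚ)) := by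
    conv_lhs => unfold chiSub
    rw [Submodule.map_span, Submodule.span_le]
    rintro _ ⟨_, ⟨a, m, rfl⟩, rfl⟩
    apply Submodule.subset_span
    refine ⟨a, g m, ?_⟩
    rw [map_sub, map_smul, map_zsmul]
  have := hst (Submodule.mem_map_of_mem h')
  rwa [hg2] at this

theorem final_bridge (hz : ∀ x : ℚˣ, phi χ (gen ℚ x) = 0) :
    Subsingleton (ChiQuot ℚ χ (Loc2 ℚ (RP' ℚ))) := by
  have hphi : ∀ w, phi χ w = 0 := by
    intro w
    have : phi χ = 0 := by
      apply Finsupp.lhom_ext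
      intro a b
      have e : (Finsupp.single a b : FreeRP ℚ) = b • gen ℚ a := by
        unfold gen; rw [Finsupp.smul_single, smul_eq_mul, mul_one]
      rw [e, map_smul, hz, smul_zero]
      rfl
    rw [this]; rfl
  refine ⟨fun v w => ?_⟩
  suffices ∀ v : ChiQuot ℚ χ (Loc2 ℚ (RP' ℚ)), v = 0 by rw [this v, this w]
  intro v
  obtain ⟨m, hm⟩ : ∃ m, mkC χ m = v := Submodule.Quotient.mk_surjective _ v
  obtain ⟨⟨y, s⟩, hys⟩ := IsLocalizedModule.surj (Submonoid.powers (2 : RF ℚ))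
    (LocalizedModule.mkLinearMap (Submonoid.powers (2 : RF ℚ)) (RP' ℚ)) m
  obtain ⟨t, ht⟩ : ∃ t, mkA t = y := Submodule.Quotient.mk_surjective _ y
  have h1 : mkC χ (mkB (mkA t)) = 0 := hphi t
  obtain ⟨s, k, rfl⟩ := s
  have hys' : ((2 : RF ℚ) ^ k) • m = mkB y := hys
  have h2 : ((2 : RF ℚ) ^ k) • v = 0 := by
    rw [← hm, ← map_smul, hys', ← ht, h1]
  clear hys h1 hm hys'
  induction k with
  | zero => rwa [pow_zero, one_smul] at h2
  | succ k ih =>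
    apply ih
    apply twoinj
    rw [smul_smul, ← pow_succ']
    exact h2

/-- the function on rationals -/
noncomputable def ff (x : ℚ) : ChiQuot ℚ χ (Loc2 ℚ (RP' ℚ)) :=
  if h : x ≠ 0 then phi χ (gen ℚ (U ℚ x h)) else 0

theorem ff_unit (x : ℚˣ) : phi χ (gen ℚ x) = ff χ x := by
  unfold ff
  rw [dif_pos x.ne_zero]
  congr 2
  ext
  rfl

theorem dat (hχm1 : χ (sqc ℚ (-1)) = 1) : Dat (XX χ) (ff χ) where
  h2 := by
    intro a ha
    apply twoinj
    rw [two_smul]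
    exact ha
  Xm := by
    intro x y
    by_cases hx : x = 0
    · simp [hx, XX]
    by_cases hy : y = 0
    · simp [hy, XX]
    lift x to ℚˣ using IsUnit.mk0 x hx
    lift y to ℚˣ using IsUnit.mk0 y hy
    rw [← Units.val_mul, XX_unit, XX_unit, XX_unit, map_mul, map_mul, Units.val_mul]
  X0 := by simp [XX]
  Xpm := by
    intro x hx
    lift x to ℚˣ using IsUnit.mk0 x hx
    rw [XX_unit]
    rcases Int.units_eq_one_or (χ (sqc ℚ x)) with h | h <;> rw [h] <;> simp
  Xn := by
    have := XX_unit χ (-1)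
    rw [hχm1] at this
    simpa using this
  f1 := by
    have := ff_unit χ 1
    rw [phi_rel χ (by simp)] at this
    simpa using this.symm
  fi := by
    intro x hx
    lift x to ℚˣ using IsUnit.mk0 x hx
    have := phi_rel χ (w := gen ℚ x⁻¹ + gen ℚ x) (Or.inr ⟨x, rfl⟩)
    rw [map_add, ff_unit, ff_unit, Units.val_inv_eq_inv_val] at this
    exact eq_neg_of_add_eq_zero_left this
  ft := by
    intro x y hx hy hx1 hy1
    lift x to ℚˣ using IsUnit.mk0 x hx
    lift y to ℚˣ using IsUnit.mk0 y hy
    have := phi_rel χ (w := FT ℚ x y hx1 hy1) (Or.inl (Or.inl (Or.inr ⟨x, y, hx1, hy1, rfl⟩)))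
    unfold FT at this
    simp only [map_add, map_sub, map_smul, cls_smul, ff_unit] at this
    rw [Units.val_mul, Units.val_inv_eq_inv_val, ← div_eq_mul_inv] at this
    exact this

end bridge

/-- Let `χ : G_ℚ → {±1}` be a character with `χ(-1) = 1`, and suppose
that `supp(χ) = {p prime : χ(p) = -1}` contains at least two distinct primes.  Then
`(RP′(ℚ)[1/2])_χ = 0`. -/
theorem statement18
    (χ : SqCl ℚ →* ℤˣ) (hχm1 : χ (sqc ℚ (-1)) = 1)
    (p q : ℕ) (hp : p.Prime) (hq : q.Prime) (hpq : p ≠ q)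
    (hχp : χ (sqv ℚ (p : ℚ)) = -1) (hχq : χ (sqv ℚ (q : ℚ)) = -1) :
    Subsingleton (ChiQuot ℚ χ (Loc2 ℚ (RP' ℚ))) := by
  have hX : ∀ n : ℕ, n.Prime → χ (sqv ℚ (n : ℚ)) = -1 → XX χ n = -1 := by
    intro n hn h
    have n0 : (n : ℚ) ≠ 0 := by exact_mod_cast hn.ne_zero
    unfold sqv at h
    rw [dif_pos n0] at h
    rw [← XX_U χ n n0, h]
    rfl
  apply final_bridge
  intro x
  rw [ff_unit]
  exact (dat χ hχm1).final hp hq hpq (hX p hp hχp) (hX q hq hχq) x x.ne_zero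
end
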